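/- arXiv:2505.11241 — 2 statements merged into one kernel-verified Lean document; each statement's English description precedes it below -/
import Mathlib

section
/- Let 0 < b < Λ and suppose (μ/σ)·(T_max/T_min)^{σ−1}·(Λ+b)/(Λ−b) < 1; let K and L be the boundedness and Lipschitz constants of Ψ on the ball {λ : ‖λ − λ₀‖_{L¹} ≤ b}, and let a > 0. If 0 < c < min{a, b/K, 1/L}, then for every initial value λ₀ ∈ L¹_Λ(Ω) there exists a unique continuously differentiable map λ: [0, c] → L¹(Ω) with λ(0) = λ₀, λ′(t) = Ψ[λ(t)] for all t ∈ [0, c], and moreover λ(t) ∈ L¹_Λ(Ω) for all t ∈ [0, c]; the constant c does not depend on λ₀. -/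
open MeasureTheory Real Set

/-- The price index operator `G[λ](x) = [(1/F) ∫_Ω |λ(y)| T(x,y)^{1-σ} dy]^{1/(1-σ)}`. -/
noncomputable def priceIndex {n : ℕ} (Ω : Set (Fin n → ℝ)) (F σ : ℝ)
    (T : (Fin n → ℝ) → (Fin n → ℝ) → ℝ) (lam : (Fin n → ℝ) → ℝ)
    (x : Fin n → ℝ) : ℝ :=
  ((1 / F) * ∫ y in Ω, |lam y| * T x y ^ (1 - σ)) ^ (1 / (1 - σ))

/-- `W` is a nonnegative continuous solution on `Ω` of the wage fixed-point equation for `lam`. -/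
def IsWageSolution {n : ℕ} (Ω : Set (Fin n → ℝ)) (F σ μ : ℝ)
    (T : (Fin n → ℝ) → (Fin n → ℝ) → ℝ) (φ lam W : (Fin n → ℝ) → ℝ) : Prop :=
  ContinuousOn W Ω ∧ (∀ x ∈ Ω, 0 ≤ W x) ∧
  ∀ x ∈ Ω, W x = (μ / (σ * F)) *
    ∫ y in Ω, (W y * |lam y| + φ y) * priceIndex Ω F σ T lam y ^ (σ - 1) * T x y ^ (1 - σ)

/-- The real wage `ω[λ] = w[λ]·G[λ]^{−μ}` built from a wage solution `W` for `lam`. -/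
noncomputable def omegaOf {n : ℕ} (Ω : Set (Fin n → ℝ)) (F σ μ : ℝ)
    (T : (Fin n → ℝ) → (Fin n → ℝ) → ℝ) (lam W : (Fin n → ℝ) → ℝ)
    (x : Fin n → ℝ) : ℝ :=
  W x * priceIndex Ω F σ T lam x ^ (-μ)

/-- The right-hand side `Ψ[λ] = v(ω[λ] − ω̃[λ])λ` of the migration dynamics,
built from a wage solution `W` for `lam`. -/
noncomputable def psiOf {n : ℕ} (Ω : Set (Fin n → ℝ)) (F σ μ Λ v : ℝ)
    (T : (Fin n → ℝ) → (Fin n → ℝ) → ℝ) (lam W : (Fin n → ℝ) → ℝ)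
    (x : Fin n → ℝ) : ℝ :=
  v * (omegaOf Ω F σ μ T lam W x -
    (1 / Λ) * ∫ y in Ω, omegaOf Ω F σ μ T lam W y * lam y) * lam x

/-- `u` is a continuously differentiable solution of the evolution equation
`λ' = Ψ[λ]`, `λ(0) = λ₀` in `L¹(Ω)` on the time set `S`, with derivative family `D`. -/
def IsSolutionOn {n : ℕ} (Ω : Set (Fin n → ℝ)) (F σ μ Λ v : ℝ)
    (T : (Fin n → ℝ) → (Fin n → ℝ) → ℝ) (φ lam₀ : (Fin n → ℝ) → ℝ)
    (S : Set ℝ) (u D : ℝ → Lp ℝ 1 (volume.restrict Ω)) : Prop :=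
  ((u 0 : (Fin n → ℝ) → ℝ) =ᵐ[volume.restrict Ω] lam₀) ∧
  ContinuousOn D S ∧
  ∀ t ∈ S, HasDerivWithinAt u (D t) S t ∧
    ∃ W : (Fin n → ℝ) → ℝ, IsWageSolution Ω F σ μ T φ ((u t : (Fin n → ℝ) → ℝ)) W ∧
      (D t : (Fin n → ℝ) → ℝ) =ᵐ[volume.restrict Ω]
        psiOf Ω F σ μ Λ v T ((u t : (Fin n → ℝ) → ℝ)) W


/-- The standing hypotheses. -/
structure Hyp {n : ℕ} (Ω : Set (Fin n → ℝ)) (T : (Fin n → ℝ) → (Fin n → ℝ) → ℝ)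
    (Tmin Tmax σ μ F : ℝ) : Prop where
  hc : IsCompact Ω
  hne : Ω.Nonempty
  hTc : ContinuousOn (fun p : (Fin n → ℝ) × (Fin n → ℝ) => T p.1 p.2) (Ω ×ˢ Ω)
  hmin : 1 ≤ Tmin
  hT : ∀ x ∈ Ω, ∀ y ∈ Ω, T x y ∈ Icc Tmin Tmax
  hσ : 1 < σ
  hμ : μ ∈ Ioo (0 : ℝ) 1
  hF : 0 < F
  hκ : μ / σ * (Tmax / Tmin) ^ (σ - 1) < 1

namespace Hyp

variable {n : ℕ} {Ω : Set (Fin n → ℝ)} {T : (Fin n → ℝ) → (Fin n → ℝ) → ℝ}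
    {Tmin Tmax σ μ F : ℝ}
    {lam φ W f : (Fin n → ℝ) → ℝ} {x y : Fin n → ℝ}

lemma ms (H : Hyp Ω T Tmin Tmax σ μ F) : MeasurableSet Ω := H.hc.measurableSet

lemma tpos (H : Hyp Ω T Tmin Tmax σ μ F) : 0 < Tmin := lt_of_lt_of_le one_pos H.hmin

lemma tpos' (H : Hyp Ω T Tmin Tmax σ μ F) : 0 < Tmax := by
  obtain ⟨x, hx⟩ := H.hne
  have := H.hT x hx x hx
  exact H.tpos.trans_le (this.1.trans this.2)

lemma kcont (H : Hyp Ω T Tmin Tmax σ μ F) : ContinuousOn (fun p : (Fin n → ℝ) × (Fin n → ℝ) => T p.1 p.2 ^ (1 - σ)) (Ω ×ˢ Ω) := by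
  apply H.hTc.rpow_const
  intro p hp
  left
  have := (H.hT p.1 hp.1 p.2 hp.2).1
  have := H.tpos
  linarith

lemma kcont1 (H : Hyp Ω T Tmin Tmax σ μ F) (hy : y ∈ Ω) : ContinuousOn (fun x => T x y ^ (1 - σ)) Ω :=
  H.kcont.comp (f := fun x => (x, y)) (by fun_prop) (fun x hx => ⟨hx, hy⟩)

lemma kcont2 (H : Hyp Ω T Tmin Tmax σ μ F) (hx : x ∈ Ω) : ContinuousOn (fun y => T x y ^ (1 - σ)) Ω :=
  H.kcont.comp (f := fun y => (x, y)) (by fun_prop) (fun y hy => ⟨hx, hy⟩)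

lemma kpos (H : Hyp Ω T Tmin Tmax σ μ F) (hx : x ∈ Ω) (hy : y ∈ Ω) : 0 < T x y ^ (1 - σ) :=
  rpow_pos_of_pos (H.tpos.trans_le (H.hT x hx y hy).1) _

lemma k_le (H : Hyp Ω T Tmin Tmax σ μ F) (hx : x ∈ Ω) (hy : y ∈ Ω) : T x y ^ (1 - σ) ≤ Tmin ^ (1 - σ) :=
  rpow_le_rpow_of_nonpos H.tpos (H.hT x hx y hy).1 (by linarith [H.hσ])

lemma le_k (H : Hyp Ω T Tmin Tmax σ μ F) (hx : x ∈ Ω) (hy : y ∈ Ω) : Tmax ^ (1 - σ) ≤ T x y ^ (1 - σ) :=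
  rpow_le_rpow_of_nonpos (H.tpos.trans_le (H.hT x hx y hy).1) (H.hT x hx y hy).2
    (by linarith [H.hσ])

lemma intk (H : Hyp Ω T Tmin Tmax σ μ F) (hf : IntegrableOn f Ω) (hx : x ∈ Ω) :
    IntegrableOn (fun y => f y * T x y ^ (1 - σ)) Ω :=
  hf.mul_continuousOn (H.kcont2 hx) H.hc

lemma contInt (H : Hyp Ω T Tmin Tmax σ μ F) (hf : IntegrableOn f Ω) :
    ContinuousOn (fun x => ∫ y in Ω, f y * T x y ^ (1 - σ)) Ω := by
  apply continuousOn_of_dominated (bound := fun y => |f y| * Tmin ^ (1 - σ))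
  · intro x hx
    exact (H.intk hf hx).aestronglyMeasurable
  · intro x hx
    filter_upwards [ae_restrict_mem H.ms] with y hy
    rw [norm_mul, Real.norm_eq_abs, Real.norm_eq_abs, abs_of_pos (H.kpos hx hy)]
    exact mul_le_mul_of_nonneg_left (H.k_le hx hy) (abs_nonneg _)
  · exact hf.abs.mul_const _
  · filter_upwards [ae_restrict_mem H.ms] with y hy
    exact continuousOn_const.mul (H.kcont1 hy)

lemma le_S (H : Hyp Ω T Tmin Tmax σ μ F) (hl : IntegrableOn lam Ω) (hx : x ∈ Ω) :
    (∫ y in Ω, |lam y|) * Tmax ^ (1 - σ) ≤ ∫ y in Ω, |lam y| * T x y ^ (1 - σ) := by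
  rw [← integral_mul_const]
  apply setIntegral_mono_on (hl.abs.mul_const _) (H.intk hl.abs hx) H.ms
  intro y hy
  exact mul_le_mul_of_nonneg_left (H.le_k hx hy) (abs_nonneg _)

lemma S_le (H : Hyp Ω T Tmin Tmax σ μ F) (hl : IntegrableOn lam Ω) (hx : x ∈ Ω) :
    ∫ y in Ω, |lam y| * T x y ^ (1 - σ) ≤ (∫ y in Ω, |lam y|) * Tmin ^ (1 - σ) := by
  rw [← integral_mul_const]
  apply setIntegral_mono_on (H.intk hl.abs hx) (hl.abs.mul_const _) H.ms
  intro y hy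
  exact mul_le_mul_of_nonneg_left (H.k_le hx hy) (abs_nonneg _)

lemma S_pos (H : Hyp Ω T Tmin Tmax σ μ F) (hl : IntegrableOn lam Ω) (hM : 0 < ∫ y in Ω, |lam y|) (hx : x ∈ Ω) :
    0 < ∫ y in Ω, |lam y| * T x y ^ (1 - σ) :=
  (mul_pos hM (rpow_pos_of_pos H.tpos' _)).trans_le (H.le_S hl hx)

lemma price_pow (H : Hyp Ω T Tmin Tmax σ μ F) (hl : IntegrableOn lam Ω) (hM : 0 < ∫ y in Ω, |lam y|) (hx : x ∈ Ω) (r : ℝ) :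
    priceIndex Ω F σ T lam x ^ r =
      ((1 / F) * ∫ y in Ω, |lam y| * T x y ^ (1 - σ)) ^ (r / (1 - σ)) := by
  unfold priceIndex
  rw [← rpow_mul (mul_nonneg (one_div_nonneg.2 H.hF.le) (H.S_pos hl hM hx).le)]
  congr 1
  ring

lemma price_pos (H : Hyp Ω T Tmin Tmax σ μ F) (hl : IntegrableOn lam Ω) (hM : 0 < ∫ y in Ω, |lam y|) (hx : x ∈ Ω) (r : ℝ) :
    0 < priceIndex Ω F σ T lam x ^ r := by
  rw [H.price_pow hl hM hx]
  exact rpow_pos_of_pos (mul_pos (one_div_pos.2 H.hF) (H.S_pos hl hM hx)) _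

lemma price_cont (H : Hyp Ω T Tmin Tmax σ μ F) (hl : IntegrableOn lam Ω) (hM : 0 < ∫ y in Ω, |lam y|) (r : ℝ) :
    ContinuousOn (fun x => priceIndex Ω F σ T lam x ^ r) Ω := by
  apply ContinuousOn.congr (f := fun x =>
      ((1 / F) * ∫ y in Ω, |lam y| * T x y ^ (1 - σ)) ^ (r / (1 - σ)))
  · apply ContinuousOn.rpow_const
    · exact continuousOn_const.mul (H.contInt hl.abs)
    · intro x hx
      left
      exact (mul_pos (one_div_pos.2 H.hF) (H.S_pos hl hM hx)).ne'
  · intro x hx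
    exact H.price_pow hl hM hx r

lemma price_neg_le (H : Hyp Ω T Tmin Tmax σ μ F) (hl : IntegrableOn lam Ω) (hM : 0 < ∫ y in Ω, |lam y|) (hx : x ∈ Ω)
    {M' : ℝ} (hM' : (∫ y in Ω, |lam y|) ≤ M') :
    priceIndex Ω F σ T lam x ^ (-μ) ≤ ((1 / F) * (M' * Tmin ^ (1 - σ))) ^ (μ / (σ - 1)) := by
  rw [H.price_pow hl hM hx]
  have h1 : -μ / (1 - σ) = μ / (σ - 1) := by
    rw [← neg_div_neg_eq]; congr 1 <;> ring
  rw [h1]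
  have := one_div_pos.2 H.hF
  apply rpow_le_rpow (mul_pos this (H.S_pos hl hM hx)).le
  · apply mul_le_mul_of_nonneg_left _ this.le
    exact (H.S_le hl hx).trans (mul_le_mul_of_nonneg_right hM' (rpow_pos_of_pos H.tpos _).le)
  · exact div_nonneg H.hμ.1.le (by linarith [H.hσ])

lemma kernel_le (H : Hyp Ω T Tmin Tmax σ μ F) (hl : IntegrableOn lam Ω) (hM : 0 < ∫ y in Ω, |lam y|) (hx : x ∈ Ω) (hy : y ∈ Ω) :
    (μ / (σ * F)) * (priceIndex Ω F σ T lam y ^ (σ - 1) * T x y ^ (1 - σ)) ≤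
      μ / σ * (Tmax / Tmin) ^ (σ - 1) / ∫ y in Ω, |lam y| := by
  have hσ := H.hσ
  have hF := H.hF
  rw [H.price_pow hl hM hy]
  have h1 : (σ - 1) / (1 - σ) = -1 := by
    rw [div_eq_iff (by linarith)]; ring
  rw [h1, rpow_neg_one]
  have hS := H.S_pos hl hM hy
  have hS' := H.le_S hl hy
  have e : (Tmax / Tmin) ^ (σ - 1) = Tmin ^ (1 - σ) / Tmax ^ (1 - σ) := by
    rw [div_rpow H.tpos'.le H.tpos.le, show 1 - σ = -(σ - 1) by ring, rpow_neg H.tpos.le,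
      rpow_neg H.tpos'.le]
    field_simp
  rw [e]
  have hk := H.k_le hx hy
  have hk0 := H.kpos hx hy
  have hm0 : 0 < Tmax ^ (1 - σ) := rpow_pos_of_pos H.tpos' _
  generalize (∫ z in Ω, |lam z| * T y z ^ (1 - σ)) = S at *
  generalize (∫ z in Ω, |lam z|) = M at *
  generalize T x y ^ (1 - σ) = k at *
  generalize Tmin ^ (1 - σ) = m1 at *
  generalize Tmax ^ (1 - σ) = m0 at *
  have hμ := H.hμ.1
  have : μ / (σ * F) * ((1 / F * S)⁻¹ * k) = μ / σ * (k / S) := by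
    field_simp
  rw [this, show μ / σ * (m1 / m0) / M = μ / σ * (m1 / (M * m0)) by field_simp]
  apply mul_le_mul_of_nonneg_left _ (by positivity)
  exact div_le_div₀ (hk0.le.trans hk) hk (by positivity) hS'

lemma int_gk (H : Hyp Ω T Tmin Tmax σ μ F) (hl : IntegrableOn lam Ω) (hM : 0 < ∫ y in Ω, |lam y|) (hf : IntegrableOn f Ω)
    (hx : x ∈ Ω) :
    IntegrableOn (fun y => f y * priceIndex Ω F σ T lam y ^ (σ - 1) * T x y ^ (1 - σ)) Ω :=
  H.intk (hf.mul_continuousOn (H.price_cont hl hM _) H.hc) hx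

lemma op_le (H : Hyp Ω T Tmin Tmax σ μ F) (hl : IntegrableOn lam Ω) (hM : 0 < ∫ y in Ω, |lam y|) (hf : IntegrableOn f Ω)
    (hx : x ∈ Ω) :
    |(μ / (σ * F)) * ∫ y in Ω, f y * priceIndex Ω F σ T lam y ^ (σ - 1) * T x y ^ (1 - σ)| ≤
      (μ / σ * (Tmax / Tmin) ^ (σ - 1) / ∫ y in Ω, |lam y|) * ∫ y in Ω, |f y| := by
  rw [← integral_const_mul, ← integral_const_mul]
  refine abs_integral_le_integral_abs.trans ?_
  apply setIntegral_mono_on ((H.int_gk hl hM hf hx).const_mul _).abs (hf.abs.const_mul _) H.ms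
  intro y hy
  have h0 : 0 ≤ μ / (σ * F) :=
    div_nonneg H.hμ.1.le (mul_nonneg (by linarith [H.hσ]) H.hF.le)
  have h1 := H.kernel_le hl hM hx hy
  have h2 := H.price_pos hl hM hy (σ - 1)
  have h3 := H.kpos hx hy
  rw [abs_mul, abs_mul, abs_mul, abs_of_nonneg h0, abs_of_pos h2, abs_of_pos h3]
  calc _ = (μ / (σ * F)) * (priceIndex Ω F σ T lam y ^ (σ - 1) * T x y ^ (1 - σ)) * |f y| := by
        ring
    _ ≤ _ := mul_le_mul_of_nonneg_right h1 (abs_nonneg _)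

lemma κ_nonneg (H : Hyp Ω T Tmin Tmax σ μ F) : 0 ≤ μ / σ * (Tmax / Tmin) ^ (σ - 1) :=
  mul_nonneg (div_nonneg H.hμ.1.le (by linarith [H.hσ]))
    (rpow_nonneg (div_nonneg H.tpos'.le H.tpos.le) _)

lemma exists_wage (H : Hyp Ω T Tmin Tmax σ μ F) (hl : IntegrableOn lam Ω) (hM : 0 < ∫ y in Ω, |lam y|)
    (hφ : IntegrableOn φ Ω) (hφ0 : ∀ᵐ x ∂(volume.restrict Ω), 0 ≤ φ x) :
    ∃ W, IsWageSolution Ω F σ μ T φ lam W := by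
  classical
  let ext : C(Ω, ℝ) → (Fin n → ℝ) → ℝ := fun W y => if h : y ∈ Ω then W ⟨y, h⟩ else 0
  have ext_eq : ∀ (W : C(Ω, ℝ)) (y : Ω), ext W y = W y := fun W y => by simp [ext]
  have ext_cont : ∀ W : C(Ω, ℝ), ContinuousOn (ext W) Ω := by
    intro W
    rw [continuousOn_iff_continuous_domRestrict]
    have : Ω.domRestrict (ext W) = W := by ext y; exact ext_eq W y
    rw [this]; exact W.continuous
  have hint : ∀ W : C(Ω, ℝ), IntegrableOn (fun y => |ext W y| * |lam y| + φ y) Ω := fun W =>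
    (IntegrableOn.continuousOn_mul (ext_cont W).abs hl.abs H.hc).add hφ
  let A0 : C(Ω, ℝ) → (Fin n → ℝ) → ℝ := fun W x => (μ / (σ * F)) *
    ∫ y in Ω, (|ext W y| * |lam y| + φ y) * priceIndex Ω F σ T lam y ^ (σ - 1) * T x y ^ (1 - σ)
  have A0c : ∀ W, ContinuousOn (A0 W) Ω := fun W =>
    continuousOn_const.mul (H.contInt ((hint W).mul_continuousOn (H.price_cont hl hM _) H.hc))
  let A : C(Ω, ℝ) → C(Ω, ℝ) := fun W => ⟨Ω.domRestrict (A0 W),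
    continuousOn_iff_continuous_domRestrict.1 (A0c W)⟩
  have : CompactSpace Ω := isCompact_iff_compactSpace.1 H.hc
  have hA : ContractingWith ⟨_, H.κ_nonneg⟩ A := by
    refine ⟨H.hκ, LipschitzWith.of_dist_le_mul fun W₁ W₂ => ?_⟩
    change _ ≤ (μ / σ * (Tmax / Tmin) ^ (σ - 1)) * _
    rw [ContinuousMap.dist_le (mul_nonneg H.κ_nonneg dist_nonneg)]
    intro x
    rw [Real.dist_eq]
    change |A0 W₁ x - A0 W₂ x| ≤ _
    have e : A0 W₁ x - A0 W₂ x = (μ / (σ * F)) * ∫ y in Ω, ((|ext W₁ y| * |lam y| + φ y) -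
        (|ext W₂ y| * |lam y| + φ y)) * priceIndex Ω F σ T lam y ^ (σ - 1) *
        T x y ^ (1 - σ) := by
      simp only [A0]
      rw [← mul_sub, ← integral_sub (H.int_gk hl hM (hint W₁) x.2) (H.int_gk hl hM (hint W₂) x.2)]
      simp only [sub_mul]
    rw [e]
    refine (H.op_le hl hM ((hint W₁).sub (hint W₂)) x.2).trans ?_
    have : ∫ y in Ω, |(|ext W₁ y| * |lam y| + φ y) - (|ext W₂ y| * |lam y| + φ y)| ≤
        dist W₁ W₂ * ∫ y in Ω, |lam y| := by
      rw [← integral_const_mul]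
      apply setIntegral_mono_on ((hint W₁).sub (hint W₂)).abs (hl.abs.const_mul _) H.ms
      intro y hy
      have : (|ext W₁ y| * |lam y| + φ y) - (|ext W₂ y| * |lam y| + φ y) =
        (|ext W₁ y| - |ext W₂ y|) * |lam y| := by ring
      rw [Pi.sub_apply, this, abs_mul, abs_abs]
      apply mul_le_mul_of_nonneg_right _ (abs_nonneg _)
      refine (abs_abs_sub_abs_le_abs_sub _ _).trans ?_
      have h1 := ContinuousMap.dist_apply_le_dist (f := W₁) (g := W₂) ⟨y, hy⟩
      rw [Real.dist_eq, ← ext_eq, ← ext_eq] at h1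
      exact h1
    calc _ ≤ (μ / σ * (Tmax / Tmin) ^ (σ - 1) / ∫ y in Ω, |lam y|) *
          (dist W₁ W₂ * ∫ y in Ω, |lam y|) :=
          mul_le_mul_of_nonneg_left this (div_nonneg H.κ_nonneg hM.le)
      _ = _ := by field_simp
  obtain ⟨W, hW, -⟩ := hA.exists_fixedPoint 0 (edist_ne_top _ _)
  have hW' : ∀ x ∈ Ω, ext W x = A0 W x := by
    intro x hx
    have h1 : A W ⟨x, hx⟩ = W ⟨x, hx⟩ := by rw [hW]
    have h2 := ext_eq W ⟨x, hx⟩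
    rw [← h1] at h2
    exact h2
  have h0 : ∀ x ∈ Ω, 0 ≤ ext W x := by
    intro x hx
    rw [hW' x hx]
    apply mul_nonneg (div_nonneg H.hμ.1.le (mul_nonneg (by linarith [H.hσ]) H.hF.le))
    apply integral_nonneg_of_ae
    filter_upwards [ae_restrict_mem H.ms, hφ0] with y hy hy0
    have h2 := H.price_pos hl hM hy (σ - 1)
    have h3 := H.kpos hx hy
    simp only [Pi.zero_apply]
    positivity
  refine ⟨ext W, ext_cont W, h0, fun x hx => ?_⟩
  rw [hW' x hx]
  change (μ / (σ * F)) * _ = _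
  congr 1
  apply setIntegral_congr_fun H.ms
  intro y hy
  simp only [abs_of_nonneg (h0 y hy)]

lemma wage_le (H : Hyp Ω T Tmin Tmax σ μ F) (hl : IntegrableOn lam Ω) (hM : 0 < ∫ y in Ω, |lam y|)
    (hφ : IntegrableOn φ Ω) (hφ0 : ∀ᵐ x ∂(volume.restrict Ω), 0 ≤ φ x)
    (hW : IsWageSolution Ω F σ μ T φ lam W) {m : ℝ} (hm : 0 < m) (hmM : m ≤ ∫ y in Ω, |lam y|)
    (hx : x ∈ Ω) :
    W x ≤ (μ / σ * (Tmax / Tmin) ^ (σ - 1)) * (∫ y in Ω, φ y) / m /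
      (1 - μ / σ * (Tmax / Tmin) ^ (σ - 1)) := by
  obtain ⟨hWc, hW0, hWe⟩ := hW
  obtain ⟨z, hz, hmax⟩ := H.hc.exists_isMaxOn H.hne hWc
  refine (hmax hx).trans ?_
  have hint : IntegrableOn (fun y => W y * |lam y| + φ y) Ω :=
    (IntegrableOn.continuousOn_mul hWc hl.abs H.hc).add hφ
  have h1 := (le_abs_self _).trans (H.op_le hl hM hint hz)
  rw [← hWe z hz] at h1
  have h2 : ∫ y in Ω, |W y * |lam y| + φ y| ≤ W z * (∫ y in Ω, |lam y|) + ∫ y in Ω, φ y := by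
    rw [← integral_const_mul, ← integral_add (hl.abs.const_mul _) hφ]
    apply integral_mono_ae hint.abs ((hl.abs.const_mul _).add hφ)
    filter_upwards [ae_restrict_mem H.ms, hφ0] with y hy hy0
    have := hW0 y hy
    rw [abs_of_nonneg (by positivity)]
    have := mul_le_mul_of_nonneg_right (hmax hy) (abs_nonneg (lam y))
    simpa using this
  have hκ := H.hκ
  have hκ0 := H.κ_nonneg
  have hΦ : 0 ≤ ∫ y in Ω, φ y := integral_nonneg_of_ae hφ0
  generalize μ / σ * (Tmax / Tmin) ^ (σ - 1) = κ at *
  generalize (∫ z in Ω, |lam z|) = M at *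
  generalize (∫ y in Ω, φ y) = Φ at *
  rw [le_div_iff₀ (by linarith)]
  have h3 : κ / M * (∫ y in Ω, |W y * |lam y| + φ y|) ≤ κ / M * (W z * M + Φ) :=
    mul_le_mul_of_nonneg_left h2 (by positivity)
  have h4 : κ / M * (W z * M + Φ) = κ * W z + κ * Φ / M := by field_simp
  have h5 : κ * Φ / M ≤ κ * Φ / m := div_le_div_of_nonneg_left (by positivity) hm hmM
  linarith

lemma omega_cont (H : Hyp Ω T Tmin Tmax σ μ F) (hl : IntegrableOn lam Ω) (hM : 0 < ∫ y in Ω, |lam y|)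
    (hW : IsWageSolution Ω F σ μ T φ lam W) : ContinuousOn (omegaOf Ω F σ μ T lam W) Ω :=
  hW.1.mul (H.price_cont hl hM _)

/-- growth rate -/
noncomputable def gOf {n : ℕ} (Ω : Set (Fin n → ℝ)) (F σ μ Λ v : ℝ)
    (T : (Fin n → ℝ) → (Fin n → ℝ) → ℝ) (lam W : (Fin n → ℝ) → ℝ)
    (x : Fin n → ℝ) : ℝ :=
  v * (omegaOf Ω F σ μ T lam W x -
    (1 / Λ) * ∫ y in Ω, omegaOf Ω F σ μ T lam W y * lam y)

lemma g_cont (H : Hyp Ω T Tmin Tmax σ μ F) (hl : IntegrableOn lam Ω) (hM : 0 < ∫ y in Ω, |lam y|) {Λ v : ℝ}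
    (hW : IsWageSolution Ω F σ μ T φ lam W) : ContinuousOn (gOf Ω F σ μ Λ v T lam W) Ω :=
  continuousOn_const.mul ((H.omega_cont hl hM hW).sub continuousOn_const)

lemma psi_int (H : Hyp Ω T Tmin Tmax σ μ F) (hl : IntegrableOn lam Ω) (hM : 0 < ∫ y in Ω, |lam y|) {Λ v : ℝ}
    (hW : IsWageSolution Ω F σ μ T φ lam W) : IntegrableOn (psiOf Ω F σ μ Λ v T lam W) Ω :=
  IntegrableOn.continuousOn_mul (H.g_cont hl hM hW) hl H.hc

lemma psi_integral (H : Hyp Ω T Tmin Tmax σ μ F) (hl : IntegrableOn lam Ω) (hM : 0 < ∫ y in Ω, |lam y|) {Λ v : ℝ} (hΛ : 0 < Λ)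
    (hW : IsWageSolution Ω F σ μ T φ lam W) :
    ∫ x in Ω, psiOf Ω F σ μ Λ v T lam W x =
      v * ((1 / Λ) * ∫ y in Ω, omegaOf Ω F σ μ T lam W y * lam y) * (Λ - ∫ x in Ω, lam x) := by
  have e : ∀ x, psiOf Ω F σ μ Λ v T lam W x = v * (omegaOf Ω F σ μ T lam W x * lam x) -
      v * ((1 / Λ) * ∫ y in Ω, omegaOf Ω F σ μ T lam W y * lam y) * lam x := by
    intro x; unfold psiOf; ring
  simp only [e]
  rw [integral_sub ((IntegrableOn.continuousOn_mul (H.omega_cont hl hM hW) hl H.hc).const_mul _)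
    (hl.const_mul _), integral_const_mul, integral_const_mul]
  field_simp

/-- Uniform bound on growth rates -/
lemma bounds (H : Hyp Ω T Tmin Tmax σ μ F) (hφ : IntegrableOn φ Ω) (hφ0 : ∀ᵐ x ∂(volume.restrict Ω), 0 ≤ φ x)
    {m M' Λ v : ℝ} (hm : 0 < m) (hΛ : 0 < Λ) (hv : 0 < v) (hmM : m ≤ M') :
    ∃ C, 0 ≤ C ∧ ∀ lam W, IntegrableOn lam Ω → m ≤ (∫ y in Ω, |lam y|) →
      (∫ y in Ω, |lam y|) ≤ M' → IsWageSolution Ω F σ μ T φ lam W →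
      |v * ((1 / Λ) * ∫ y in Ω, omegaOf Ω F σ μ T lam W y * lam y)| ≤ C ∧
      ∀ x ∈ Ω, |gOf Ω F σ μ Λ v T lam W x| ≤ C := by
  set κ := μ / σ * (Tmax / Tmin) ^ (σ - 1) with hκd
  have hκ0 : 0 ≤ κ := H.κ_nonneg
  have hκ1 : κ < 1 := H.hκ
  have hΦ : 0 ≤ ∫ y in Ω, φ y := integral_nonneg_of_ae hφ0
  set B := κ * (∫ y in Ω, φ y) / m / (1 - κ)
  have hB : 0 ≤ B := div_nonneg (by positivity) (by linarith)
  set P := ((1 / F) * (M' * Tmin ^ (1 - σ))) ^ (μ / (σ - 1))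
  have hM'0 : 0 ≤ M' := hm.le.trans hmM
  have hP : 0 ≤ P := by
    have := H.tpos
    have := H.hF
    positivity
  refine ⟨v * (B * P + 1 / Λ * (B * P * M')), by positivity, ?_⟩
  intro lam W hl h1 h2 hW
  have hM := hm.trans_le h1
  have hω : ∀ x ∈ Ω, |omegaOf Ω F σ μ T lam W x| ≤ B * P := by
    intro x hx
    unfold omegaOf
    have h5 := H.price_pos hl hM hx (-μ)
    rw [abs_mul, abs_of_nonneg (hW.2.1 x hx), abs_of_pos h5]
    exact mul_le_mul (H.wage_le hl hM hφ hφ0 hW hm h1 hx) (H.price_neg_le hl hM hx h2) h5.le hB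
  have hI : |∫ y in Ω, omegaOf Ω F σ μ T lam W y * lam y| ≤ B * P * M' := by
    refine abs_integral_le_integral_abs.trans ?_
    calc _ ≤ ∫ y in Ω, B * P * |lam y| := by
          apply setIntegral_mono_on
            (IntegrableOn.continuousOn_mul (H.omega_cont hl hM hW) hl H.hc).abs
            (hl.abs.const_mul _) H.ms
          intro y hy
          rw [abs_mul]
          exact mul_le_mul_of_nonneg_right (hω y hy) (abs_nonneg _)
      _ ≤ _ := by
          rw [integral_const_mul]
          exact mul_le_mul_of_nonneg_left h2 (by positivity)
  have hJ : |(1 / Λ) * ∫ y in Ω, omegaOf Ω F σ μ T lam W y * lam y| ≤ 1 / Λ * (B * P * M') := by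
    rw [abs_mul, abs_of_pos (by positivity : 0 < 1 / Λ)]
    exact mul_le_mul_of_nonneg_left hI (by positivity)
  constructor
  · rw [abs_mul, abs_of_pos hv]
    apply mul_le_mul_of_nonneg_left _ hv.le
    exact hJ.trans (le_add_of_nonneg_left (by positivity))
  · intro x hx
    unfold gOf
    rw [abs_mul, abs_of_pos hv]
    apply mul_le_mul_of_nonneg_left _ hv.le
    exact (abs_sub _ _).trans (add_le_add (hω x hx) hJ)

end Hyp

section aux

open scoped NNReal Topology

variable {α : Type*} [MeasurableSpace α] {ν : Measure α}

lemma L1_norm (p : Lp ℝ 1 ν) : ‖p‖ = ∫ x, |p x| ∂ν := by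
  rw [L1.norm_eq_integral_norm]; rfl

lemma L1_int (p : Lp ℝ 1 ν) : Integrable (p : α → ℝ) ν := L1.integrable_coeFn p

lemma L1_norm_of_ae (p : Lp ℝ 1 ν) {f : α → ℝ} (h : p =ᵐ[ν] f) : ‖p‖ = ∫ x, |f x| ∂ν := by
  rw [L1_norm]
  apply integral_congr_ae
  filter_upwards [h] with x hx
  rw [hx]

lemma L1_norm_sub (p q : Lp ℝ 1 ν) : ‖p - q‖ = ∫ x, |p x - q x| ∂ν :=
  L1_norm_of_ae _ (Lp.coeFn_sub p q)

/-- trajectories stay in the ball -/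
lemma stay_ball {E : Type*} [NormedAddCommGroup E] [NormedSpace ℝ E] {u D : ℝ → E} {x₀ : E}
    {b c K : ℝ} (hc : 0 < c) (hb : 0 < b) (hK : K * c < b) (h0 : u 0 = x₀)
    (hu : ∀ t ∈ Icc 0 c, HasDerivWithinAt u (D t) (Icc 0 c) t)
    (hD : ∀ t ∈ Icc 0 c, ‖u t - x₀‖ ≤ b → ‖D t‖ ≤ K) :
    ∀ t ∈ Icc 0 c, ‖u t - x₀‖ ≤ b := by
  have key := image_norm_le_of_norm_deriv_right_lt_deriv_boundary' (f := fun t => u t - x₀)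
    (f' := D) (a := 0) (b := c) (B := fun t => (b / c) * t) (B' := fun _ => b / c)
    (fun t ht => ((hu t ht).sub_const x₀).continuousWithinAt)
    (fun t ht => ((hu t ⟨ht.1, ht.2.le⟩).sub_const x₀).mono_of_mem_nhdsWithin
      (Icc_mem_nhdsGE_of_mem ht))
    (by simp [h0]) (by fun_prop)
    (fun t _ => by simpa using ((hasDerivAt_id t).const_mul (b / c)).hasDerivWithinAt)
    (fun t ht h => by
      have hlt : K < b / c := by rwa [lt_div_iff₀ hc]
      refine lt_of_le_of_lt (hD t ⟨ht.1, ht.2.le⟩ ?_) hlt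
      rw [h, div_mul_eq_mul_div, div_le_iff₀ hc]
      exact mul_le_mul_of_nonneg_left ht.2.le hb.le)
  intro t ht
  refine (key ht).trans ?_
  rw [div_mul_eq_mul_div, div_le_iff₀ hc]
  exact mul_le_mul_of_nonneg_left ht.2 hb.le

/-- Conservation of mass and positivity for `u' = g u` in `L¹`. -/
lemma mass_pos {u D : ℝ → Lp ℝ 1 ν} {g : ℝ → α → ℝ} {w : ℝ → ℝ} {c C Λ : ℝ} (hC : 0 ≤ C)
    (hu : ∀ t ∈ Icc 0 c, HasDerivWithinAt u (D t) (Icc 0 c) t)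
    (hD : ∀ t ∈ Icc 0 c, D t =ᵐ[ν] fun x => g t x * u t x)
    (hg : ∀ t ∈ Icc 0 c, ∀ᵐ x ∂ν, |g t x| ≤ C)
    (hgi : ∀ t ∈ Icc 0 c, Integrable (fun x => g t x * |u t x|) ν)
    (hw : ∀ t ∈ Icc 0 c, ∫ x, g t x * u t x ∂ν = w t * (Λ - ∫ x, u t x ∂ν))
    (hwC : ∀ t ∈ Icc 0 c, |w t| ≤ C)
    (h0 : ∀ᵐ x ∂ν, 0 ≤ u 0 x) (h0Λ : ∫ x, u 0 x ∂ν = Λ) :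
    ∀ t ∈ Icc 0 c, (∀ᵐ x ∂ν, 0 ≤ u t x) ∧ ∫ x, u t x ∂ν = Λ := by
  have hucont : ContinuousOn u (Icc 0 c) := fun t ht => (hu t ht).continuousWithinAt
  have hgu : ∀ t ∈ Icc 0 c, Integrable (fun x => g t x * u t x) ν := fun t ht =>
    (L1_int (D t)).congr (hD t ht)
  have hmass : ∀ t ∈ Icc 0 c, (∫ x, u t x ∂ν) - Λ = 0 := by
    let I : Lp ℝ 1 ν →L[ℝ] ℝ := L1.integralCLM
    have hI : ∀ p, I p = ∫ x, p x ∂ν := fun p => by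
      rw [← L1.integral_eq_integral]; rw [L1.integral_def]
    have h1 : ∀ t ∈ Icc 0 c, HasDerivWithinAt (fun t => (∫ x, u t x ∂ν) - Λ)
        (∫ x, D t x ∂ν) (Icc 0 c) t := by
      intro t ht
      have := (I.hasFDerivAt.comp_hasDerivWithinAt t (hu t ht)).sub_const Λ
      rw [hI] at this
      refine this.congr_of_mem (fun s _ => ?_) ht
      simp [hI]
    refine eq_zero_of_abs_deriv_le_mul_abs_self_of_eq_zero_right (K := C)
      (fun t ht => (h1 t ht).continuousWithinAt)
      (fun t ht => (h1 t ⟨ht.1, ht.2.le⟩).mono_of_mem_nhdsWithin (Icc_mem_nhdsGE_of_mem ht))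
      (by simp [h0Λ]) ?_
    intro t ht
    have ht' : t ∈ Icc 0 c := ⟨ht.1, ht.2.le⟩
    rw [integral_congr_ae (hD t ht'), hw t ht', norm_mul, norm_sub_rev]
    exact mul_le_mul_of_nonneg_right (hwC t ht') (norm_nonneg _)
  have hP : ∀ t ∈ Icc 0 c, ‖u t‖ - Λ ≤ gronwallBound 0 C 0 (t - 0) := by
    refine le_gronwallBound_of_liminf_deriv_right_le (f' := fun t => ∫ x, g t x * |u t x| ∂ν)
      ((continuous_norm.comp_continuousOn hucont).sub continuousOn_const) ?_ ?_ ?_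
    · intro t ht r hr
      have ht' : t ∈ Icc 0 c := ⟨ht.1, ht.2.le⟩
      apply Filter.Eventually.frequently
      have hd : HasDerivWithinAt u (D t) (Ici t) t :=
        (hu t ht').mono_of_mem_nhdsWithin (Icc_mem_nhdsGE_of_mem ht)
      have hd2 := hd.mono Ioi_subset_Ici_self
      rw [hasDerivWithinAt_iff_isLittleO] at hd2
      set f' := ∫ x, g t x * |u t x| ∂ν with hf'
      have hε : 0 < (r - f') / 2 := by linarith
      have ev := hd2.def hε
      have ev2 : ∀ᶠ z in 𝓝[>] t, (z - t) * C < 1 := by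
        have : Filter.Tendsto (fun z : ℝ => (z - t) * C) (𝓝[>] t) (𝓝 ((t - t) * C)) :=
          (Continuous.tendsto (by fun_prop) t).mono_left nhdsWithin_le_nhds
        rw [sub_self, zero_mul] at this
        exact this.eventually (gt_mem_nhds one_pos)
      filter_upwards [ev, ev2, self_mem_nhdsWithin] with z hz hz2 hz3
      have hzt : 0 < z - t := sub_pos.2 hz3
      have hn : ‖u t + (z - t) • D t‖ = ‖u t‖ + (z - t) * f' := by
        rw [L1_norm_of_ae _ ((Lp.coeFn_add (u t) ((z - t) • D t))), L1_norm (u t), hf',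
          ← integral_const_mul, ← integral_add (L1_int (u t)).abs ((hgi t ht').const_mul _)]
        apply integral_congr_ae
        filter_upwards [hD t ht', hg t ht', Lp.coeFn_smul (z - t) (D t)] with x h1 h2 h3
        rw [Pi.add_apply, h3, Pi.smul_apply, h1, smul_eq_mul]
        have : u t x + (z - t) * (g t x * u t x) = (1 + (z - t) * g t x) * u t x := by ring
        rw [this, abs_mul, abs_of_nonneg]
        · ring
        · have := (abs_le.1 h2).1
          nlinarith
      have hz4 : ‖u z‖ ≤ ‖u t + (z - t) • D t‖ + ‖u z - u t - (z - t) • D t‖ := by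
        have : u z = (u t + (z - t) • D t) + (u z - u t - (z - t) • D t) := by abel
        conv_lhs => rw [this]
        exact norm_add_le _ _
      rw [Real.norm_eq_abs, abs_of_pos hzt] at hz
      rw [inv_mul_lt_iff₀ hzt]
      nlinarith
    · rw [L1_norm]
      have : ∫ x, |u 0 x| ∂ν = Λ := by
        rw [← h0Λ]
        apply integral_congr_ae
        filter_upwards [h0] with x hx using abs_of_nonneg hx
      rw [this, sub_self]
    · intro t ht
      have ht' : t ∈ Icc 0 c := ⟨ht.1, ht.2.le⟩
      have hm := hmass t ht'
      have h1 := hw t ht'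
      rw [show Λ - ∫ x, u t x ∂ν = 0 by linarith, mul_zero] at h1
      have h2 : ∫ x, g t x * |u t x| ∂ν = ∫ x, (g t x * |u t x| - g t x * u t x) ∂ν := by
        rw [integral_sub (hgi t ht') (hgu t ht'), h1, sub_zero]
      have h3 : ‖u t‖ - Λ = ∫ x, (|u t x| - u t x) ∂ν := by
        rw [integral_sub (L1_int (u t)).abs (L1_int (u t)), ← L1_norm]; linarith
      rw [h2, h3, add_zero, ← integral_const_mul]
      apply integral_mono_ae ((hgi t ht').sub (hgu t ht'))
        (((L1_int (u t)).abs.sub (L1_int (u t))).const_mul _)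
      filter_upwards [hg t ht'] with x hx
      have := (abs_le.1 hx).2
      have h5 := le_abs_self (u t x)
      simp only [Pi.sub_apply]
      nlinarith
  intro t ht
  have hm := hmass t ht
  refine ⟨?_, by linarith⟩
  have h1 := hP t ht
  rw [gronwallBound_ε0_δ0] at h1
  have h3 : ∫ x, (|u t x| - u t x) ∂ν ≤ 0 := by
    rw [integral_sub (L1_int (u t)).abs (L1_int (u t)), ← L1_norm]; linarith
  have h4 : 0 ≤ᵐ[ν] fun x => |u t x| - u t x :=
    Filter.Eventually.of_forall fun x => sub_nonneg.2 (le_abs_self _)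
  have h5 := (integral_eq_zero_iff_of_nonneg_ae h4 ((L1_int (u t)).abs.sub (L1_int (u t)))).1
    (le_antisymm h3 (integral_nonneg_of_ae h4))
  filter_upwards [h5] with x hx
  have : |u t x| = u t x := by simpa [sub_eq_zero] using hx
  rw [← this]; exact abs_nonneg _

end aux

theorem local_existence_uniqueness {n : ℕ} (Ω : Set (Fin n → ℝ))
    (hΩc : IsCompact Ω) (hΩpos : 0 < volume Ω)
    (T : (Fin n → ℝ) → (Fin n → ℝ) → ℝ)
    (hTcont : ContinuousOn (fun p : (Fin n → ℝ) × (Fin n → ℝ) => T p.1 p.2) (Ω ×ˢ Ω))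
    (Tmin Tmax : ℝ) (hTmin : 1 ≤ Tmin)
    (hT : ∀ x ∈ Ω, ∀ y ∈ Ω, T x y ∈ Icc Tmin Tmax)
    (σ μ F v Λ Φ : ℝ) (hσ : 1 < σ) (hμ : μ ∈ Ioo (0 : ℝ) 1) (hF : 0 < F)
    (hv : 0 < v) (hΛ : 0 < Λ) (hΦ : 0 < Φ)
    (φ : (Fin n → ℝ) → ℝ) (hφint : IntegrableOn φ Ω)
    (hφ0 : ∀ᵐ x ∂(volume.restrict Ω), 0 ≤ φ x) (hφΦ : (∫ x in Ω, φ x) = Φ)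
    (b : ℝ) (hb : 0 < b) (hbΛ : b < Λ)
    (hcond : μ / σ * (Tmax / Tmin) ^ (σ - 1) * ((Λ + b) / (Λ - b)) < 1)
    (K L a : ℝ) (hK : 0 < K) (hL : 0 < L) (ha : 0 < a)
    (hKbound : ∀ lam₀ : (Fin n → ℝ) → ℝ, IntegrableOn lam₀ Ω →
      (∀ᵐ x ∂(volume.restrict Ω), 0 ≤ lam₀ x) → (∫ x in Ω, lam₀ x) = Λ →
      ∀ lam : (Fin n → ℝ) → ℝ, IntegrableOn lam Ω →
        (∫ x in Ω, |lam x - lam₀ x|) ≤ b →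
        ∀ W : (Fin n → ℝ) → ℝ, IsWageSolution Ω F σ μ T φ lam W →
          (∫ x in Ω, |psiOf Ω F σ μ Λ v T lam W x|) ≤ K)
    (hLbound : ∀ lam₀ : (Fin n → ℝ) → ℝ, IntegrableOn lam₀ Ω →
      (∀ᵐ x ∂(volume.restrict Ω), 0 ≤ lam₀ x) → (∫ x in Ω, lam₀ x) = Λ →
      ∀ lam₁ lam₂ : (Fin n → ℝ) → ℝ,
        IntegrableOn lam₁ Ω → IntegrableOn lam₂ Ω →
        (∫ x in Ω, |lam₁ x - lam₀ x|) ≤ b → (∫ x in Ω, |lam₂ x - lam₀ x|) ≤ b →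
        ∀ W₁ W₂ : (Fin n → ℝ) → ℝ,
          IsWageSolution Ω F σ μ T φ lam₁ W₁ → IsWageSolution Ω F σ μ T φ lam₂ W₂ →
          (∫ x in Ω, |psiOf Ω F σ μ Λ v T lam₁ W₁ x - psiOf Ω F σ μ Λ v T lam₂ W₂ x|) ≤
            L * ∫ x in Ω, |lam₁ x - lam₂ x|)
    (c : ℝ) (hc : 0 < c) (hcmin : c < min a (min (b / K) (1 / L)))
    (lam₀ : (Fin n → ℝ) → ℝ) (hlam₀ : IntegrableOn lam₀ Ω)
    (hlam₀0 : ∀ᵐ x ∂(volume.restrict Ω), 0 ≤ lam₀ x)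
    (hlam₀Λ : (∫ x in Ω, lam₀ x) = Λ) :
    ∃ u D : ℝ → Lp ℝ 1 (volume.restrict Ω),
      IsSolutionOn Ω F σ μ Λ v T φ lam₀ (Icc 0 c) u D ∧
      (∀ t ∈ Icc (0 : ℝ) c,
        (∀ᵐ x ∂(volume.restrict Ω), 0 ≤ (u t : (Fin n → ℝ) → ℝ) x) ∧
        (∫ x in Ω, (u t : (Fin n → ℝ) → ℝ) x) = Λ) ∧
      ∀ u' D' : ℝ → Lp ℝ 1 (volume.restrict Ω),
        IsSolutionOn Ω F σ μ Λ v T φ lam₀ (Icc 0 c) u' D' →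
        ∀ t ∈ Icc (0 : ℝ) c, u' t = u t := by
  classical
  have hne : Ω.Nonempty := by
    by_contra h
    rw [not_nonempty_iff_eq_empty] at h
    simp [h] at hΩpos
  have htp : 0 < Tmin := lt_of_lt_of_le one_pos hTmin
  have hκ : μ / σ * (Tmax / Tmin) ^ (σ - 1) < 1 := by
    obtain ⟨x, hx⟩ := hne
    have hTm : 0 < Tmax := htp.trans_le ((hT x hx x hx).1.trans (hT x hx x hx).2)
    have h0 : 0 ≤ μ / σ * (Tmax / Tmin) ^ (σ - 1) :=
      mul_nonneg (div_nonneg hμ.1.le (by linarith)) (rpow_nonneg (by positivity) _)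
    have h1 : 1 ≤ (Λ + b) / (Λ - b) := by
      rw [le_div_iff₀ (by linarith)]; linarith
    nlinarith
  have H : Hyp Ω T Tmin Tmax σ μ F := ⟨hΩc, hne, hTcont, hTmin, hT, hσ, hμ, hF, hκ⟩
  -- the initial point
  let x₀ : Lp ℝ 1 (volume.restrict Ω) := Integrable.toL1 lam₀ hlam₀
  have hx₀ : x₀ =ᵐ[volume.restrict Ω] lam₀ := Integrable.coeFn_toL1 hlam₀
  have hx₀i : IntegrableOn x₀ Ω := L1_int x₀
  have hx₀0 : ∀ᵐ x ∂(volume.restrict Ω), 0 ≤ x₀ x := by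
    filter_upwards [hx₀, hlam₀0] with x h1 h2
    rw [h1]; exact h2
  have hx₀Λ : ∫ x in Ω, x₀ x = Λ := by rw [integral_congr_ae hx₀, hlam₀Λ]
  have hx₀n : ‖x₀‖ = Λ := by
    rw [L1_norm, ← hx₀Λ]
    apply integral_congr_ae
    filter_upwards [hx₀0] with x hx using abs_of_nonneg hx
  have hmass : ∀ p : Lp ℝ 1 (volume.restrict Ω), ‖p - x₀‖ ≤ b →
      Λ - b ≤ (∫ y in Ω, |p y|) ∧ (∫ y in Ω, |p y|) ≤ Λ + b := by
    intro p hp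
    rw [← L1_norm, ← hx₀n]
    have h1 := norm_sub_norm_le x₀ p
    have h2 := norm_sub_norm_le p x₀
    rw [norm_sub_rev] at h1
    constructor <;> linarith
  have hm : 0 < Λ - b := by linarith
  -- the vector field
  have hex : ∀ p : Lp ℝ 1 (volume.restrict Ω), ∃ q : Lp ℝ 1 (volume.restrict Ω),
      ‖p - x₀‖ ≤ b → ∃ W, IsWageSolution Ω F σ μ T φ p W ∧
        q =ᵐ[volume.restrict Ω] psiOf Ω F σ μ Λ v T p W := by
    intro p
    by_cases hp : ‖p - x₀‖ ≤ b
    · have hM := hm.trans_le (hmass p hp).1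
      obtain ⟨W, hW⟩ := H.exists_wage (L1_int p) hM hφint hφ0
      exact ⟨Integrable.toL1 _ (H.psi_int (L1_int p) hM hW), fun _ =>
        ⟨W, hW, Integrable.coeFn_toL1 _⟩⟩
    · exact ⟨0, fun h => absurd h hp⟩
  choose Psi hPsi using hex
  -- consequences of the two bounds
  have hKb : ∀ p q : Lp ℝ 1 (volume.restrict Ω), ‖p - x₀‖ ≤ b → ∀ W,
      IsWageSolution Ω F σ μ T φ p W → q =ᵐ[volume.restrict Ω] psiOf Ω F σ μ Λ v T p W →
      ‖q‖ ≤ K := by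
    intro p q hp W hW hq
    rw [L1_norm_of_ae _ hq]
    rw [L1_norm_sub] at hp
    exact hKbound x₀ hx₀i hx₀0 hx₀Λ p (L1_int p) hp W hW
  have hLb : ∀ p₁ p₂ q₁ q₂ : Lp ℝ 1 (volume.restrict Ω), ‖p₁ - x₀‖ ≤ b → ‖p₂ - x₀‖ ≤ b →
      ∀ W₁ W₂, IsWageSolution Ω F σ μ T φ p₁ W₁ → IsWageSolution Ω F σ μ T φ p₂ W₂ →
      q₁ =ᵐ[volume.restrict Ω] psiOf Ω F σ μ Λ v T p₁ W₁ →
      q₂ =ᵐ[volume.restrict Ω] psiOf Ω F σ μ Λ v T p₂ W₂ →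
      ‖q₁ - q₂‖ ≤ L * ‖p₁ - p₂‖ := by
    intro p₁ p₂ q₁ q₂ hp₁ hp₂ W₁ W₂ hW₁ hW₂ hq₁ hq₂
    rw [L1_norm_of_ae _ ((Lp.coeFn_sub q₁ q₂).trans (hq₁.sub hq₂)), L1_norm_sub]
    rw [L1_norm_sub] at hp₁ hp₂
    exact hLbound x₀ hx₀i hx₀0 hx₀Λ p₁ p₂ (L1_int p₁) (L1_int p₂) hp₁ hp₂ W₁ W₂ hW₁ hW₂
  have hLip : LipschitzOnWith ⟨L, hL.le⟩ Psi (Metric.closedBall x₀ b) := by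
    apply LipschitzOnWith.of_dist_le_mul
    intro p hp q hq
    rw [mem_closedBall_iff_norm] at hp hq
    obtain ⟨W₁, hW₁, h₁⟩ := hPsi p hp
    obtain ⟨W₂, hW₂, h₂⟩ := hPsi q hq
    rw [dist_eq_norm, dist_eq_norm]
    exact hLb p q _ _ hp hq W₁ W₂ hW₁ hW₂ h₁ h₂
  have hcb : K * c < b := by
    have : c < b / K := hcmin.trans_le ((min_le_right _ _).trans (min_le_left _ _))
    rw [lt_div_iff₀ hK] at this
    linarith
  have hPL : IsPicardLindelof (fun _ : ℝ => Psi) (tmin := 0) (tmax := c) ⟨0, left_mem_Icc.2 hc.le⟩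
      x₀ ⟨b, hb.le⟩ 0 ⟨K, hK.le⟩ ⟨L, hL.le⟩ := by
    refine ⟨fun _ _ => hLip, fun _ _ => continuousOn_const, ?_, ?_⟩
    · intro _ _ p hp
      have hp' : ‖p - x₀‖ ≤ b := mem_closedBall_iff_norm.1 hp
      obtain ⟨W, hW, h⟩ := hPsi p hp'
      exact hKb p _ hp' W hW h
    · change K * max (c - 0) (0 - 0) ≤ b - 0
      rw [sub_zero, sub_zero, sub_zero, max_eq_left hc.le]
      exact hcb.le
  obtain ⟨u, hu0, hu⟩ := hPL.exists_eq_forall_mem_Icc_hasDerivWithinAt₀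
  replace hu0 : u 0 = x₀ := hu0
  have hball : ∀ t ∈ Icc 0 c, ‖u t - x₀‖ ≤ b := by
    refine stay_ball hc hb hcb hu0 hu ?_
    intro t _ hp
    obtain ⟨W, hW, h⟩ := hPsi _ hp
    exact hKb _ _ hp W hW h
  have hucont : ContinuousOn u (Icc 0 c) := fun t ht => (hu t ht).continuousWithinAt
  have hball' : ∀ t ∈ Icc 0 c, u t ∈ Metric.closedBall x₀ b := fun t ht =>
    mem_closedBall_iff_norm.2 (hball t ht)
  refine ⟨u, fun t => Psi (u t), ⟨?_, ?_, ?_⟩, ?_, ?_⟩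
  · rw [hu0]; exact hx₀
  · exact hLip.continuousOn.comp hucont hball'
  · intro t ht
    exact ⟨hu t ht, hPsi _ (hball t ht)⟩
  · obtain ⟨C, hC0, hC⟩ := H.bounds (Λ := Λ) (v := v) hφint hφ0 hm hΛ hv
      (show Λ - b ≤ Λ + b by linarith)
    have hW' : ∀ t, ∃ W, t ∈ Icc 0 c → IsWageSolution Ω F σ μ T φ (u t) W ∧
        Psi (u t) =ᵐ[volume.restrict Ω] psiOf Ω F σ μ Λ v T (u t) W := by
      intro t
      by_cases ht : t ∈ Icc 0 c
      · obtain ⟨W, hW⟩ := hPsi _ (hball t ht)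
        exact ⟨W, fun _ => hW⟩
      · exact ⟨0, fun h => absurd h ht⟩
    choose W hW using hW'
    have hM : ∀ t ∈ Icc 0 c, 0 < ∫ y in Ω, |u t y| := fun t ht =>
      hm.trans_le (hmass _ (hball t ht)).1
    have hCt := fun t (ht : t ∈ Icc 0 c) => hC (u t) (W t) (L1_int (u t)) (hmass _ (hball t ht)).1
      (hmass _ (hball t ht)).2 (hW t ht).1
    refine mass_pos (D := fun t => Psi (u t)) (g := fun t => Hyp.gOf Ω F σ μ Λ v T (u t) (W t))
      (w := fun t => v * ((1 / Λ) * ∫ y in Ω, omegaOf Ω F σ μ T (u t) (W t) y * u t y))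
      hC0 hu (fun t ht => (hW t ht).2) ?_ ?_ ?_ (fun t ht => (hCt t ht).1) ?_ ?_
    · intro t ht
      filter_upwards [ae_restrict_mem H.ms] with x hx using (hCt t ht).2 x hx
    · intro t ht
      exact IntegrableOn.continuousOn_mul (H.g_cont (L1_int (u t)) (hM t ht) (hW t ht).1)
        (L1_int (u t)).abs H.hc
    · intro t ht
      exact H.psi_integral (L1_int (u t)) (hM t ht) hΛ (hW t ht).1
    · rw [hu0]; exact hx₀0
    · rw [hu0]; exact hx₀Λ
  · rintro u' D' ⟨h0, -, hs⟩
    have h0' : u' 0 = x₀ := Lp.ext (h0.trans hx₀.symm)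
    have hball2 : ∀ t ∈ Icc 0 c, ‖u' t - x₀‖ ≤ b := by
      refine stay_ball hc hb hcb h0' (fun t ht => (hs t ht).1) ?_
      intro t ht hp
      obtain ⟨W, hW, h⟩ := (hs t ht).2
      exact hKb _ _ hp W hW h
    have hD' : ∀ t ∈ Icc 0 c, D' t = Psi (u' t) := by
      intro t ht
      obtain ⟨W₁, hW₁, h₁⟩ := (hs t ht).2
      obtain ⟨W₂, hW₂, h₂⟩ := hPsi _ (hball2 t ht)
      have := hLb _ _ _ _ (hball2 t ht) (hball2 t ht) W₁ W₂ hW₁ hW₂ h₁ h₂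
      rw [sub_self, norm_zero, mul_zero] at this
      exact sub_eq_zero.1 (norm_le_zero_iff.1 this)
    have := ODE_solution_unique_of_mem_Icc_right (v := fun _ => Psi)
      (s := fun _ => Metric.closedBall x₀ b) (f := u') (g := u) (a := 0) (b := c)
      (fun _ _ => hLip)
      (fun t ht => (hs t ht).1.continuousWithinAt)
      (fun t ht => by
        have ht' : t ∈ Icc 0 c := ⟨ht.1, ht.2.le⟩
        have := (hs t ht').1
        rw [hD' t ht'] at this
        exact this.mono_of_mem_nhdsWithin (Icc_mem_nhdsGE_of_mem ht))
      (fun t ht => mem_closedBall_iff_norm.2 (hball2 t ⟨ht.1, ht.2.le⟩))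
      hucont
      (fun t ht => (hu t ⟨ht.1, ht.2.le⟩).mono_of_mem_nhdsWithin (Icc_mem_nhdsGE_of_mem ht))
      (fun t ht => hball' t ⟨ht.1, ht.2.le⟩)
      (h0'.trans hu0.symm)
    exact this
end

section
/- Suppose there exists b with 0 < b < Λ such that (μ/σ)·(T_max/T_min)^{σ−1}·(Λ+b)/(Λ−b) < 1. Then for every λ₀ ∈ L¹_Λ(Ω) there exists a unique continuously differentiable map λ: [0, ∞) → L¹(Ω) with λ(0) = λ₀, λ′(t) = Ψ[λ(t)] for all t ≥ 0, and λ(t) ∈ L¹_Λ(Ω) for all t ≥ 0. -/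
open MeasureTheory Real Set

open scoped NNReal BoundedContinuousFunction Topology

/-- bounded and Lipschitz on a set -/
def LipB {E G : Type*} [NormedAddCommGroup E] [NormedAddCommGroup G] (S : Set E) (f : E → G) :
    Prop :=
  ∃ C : ℝ, 0 ≤ C ∧ (∀ x ∈ S, ‖f x‖ ≤ C) ∧ ∀ x ∈ S, ∀ y ∈ S, ‖f x - f y‖ ≤ C * ‖x - y‖

section LipBsec
set_option linter.unusedSectionVars false
variable {E G H I : Type*} [NormedAddCommGroup E] [NormedAddCommGroup G] [NormedAddCommGroup H]
  [NormedAddCommGroup I] [NormedSpace ℝ G] [NormedSpace ℝ H] [NormedSpace ℝ I] {S : Set E}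

theorem LipB.const (c : G) : LipB S (fun _ : E => c) :=
  ⟨‖c‖, norm_nonneg _, fun _ _ => le_rfl, fun x _ y _ => by simp; positivity⟩

theorem LipB.add {f g : E → G} (hf : LipB S f) (hg : LipB S g) : LipB S (fun x => f x + g x) := by
  obtain ⟨C, hC, h1, h2⟩ := hf
  obtain ⟨D, hD, h3, h4⟩ := hg
  refine ⟨C + D, by positivity, fun x hx => (norm_add_le _ _).trans (add_le_add (h1 x hx) (h3 x hx)),
    fun x hx y hy => ?_⟩
  have e : f x + g x - (f y + g y) = (f x - f y) + (g x - g y) := by abel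
  rw [e, add_mul]
  exact (norm_add_le _ _).trans (add_le_add (h2 x hx y hy) (h4 x hx y hy))

theorem LipB.bilin (B : G →L[ℝ] H →L[ℝ] I) {f : E → G} {g : E → H}
    (hf : LipB S f) (hg : LipB S g) : LipB S (fun x => B (f x) (g x)) := by
  obtain ⟨C, hC, h1, h2⟩ := hf
  obtain ⟨D, hD, h3, h4⟩ := hg
  refine ⟨‖B‖ * C * D + ‖B‖ * C * D, by positivity, fun x hx => ?_, fun x hx y hy => ?_⟩
  · calc ‖B (f x) (g x)‖ ≤ ‖B‖ * ‖f x‖ * ‖g x‖ := B.le_opNorm₂ _ _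
      _ ≤ ‖B‖ * C * D := by gcongr; exacts [h1 x hx, h3 x hx]
      _ ≤ _ := by linarith [show 0 ≤ ‖B‖ * C * D by positivity]
  · have e : B (f x) (g x) - B (f y) (g y) = B (f x - f y) (g x) + B (f y) (g x - g y) := by
      simp
    rw [e]
    calc _ ≤ ‖B‖ * ‖f x - f y‖ * ‖g x‖ + ‖B‖ * ‖f y‖ * ‖g x - g y‖ :=
          (norm_add_le _ _).trans (add_le_add (B.le_opNorm₂ _ _) (B.le_opNorm₂ _ _))
      _ ≤ ‖B‖ * (C * ‖x - y‖) * D + ‖B‖ * C * (D * ‖x - y‖) := by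
          gcongr
          exacts [h2 x hx y hy, h3 x hx, h1 y hy, h4 x hx y hy]
      _ = _ := by ring

theorem LipB.clm (A : G →L[ℝ] H) {f : E → G} (hf : LipB S f) : LipB S (fun x => A (f x)) :=
  LipB.bilin (ContinuousLinearMap.id ℝ (G →L[ℝ] H)) (LipB.const A) hf

theorem LipB.smul_const (c : ℝ) {f : E → G} (hf : LipB S f) : LipB S (fun x => c • f x) :=
  LipB.clm (c • ContinuousLinearMap.id ℝ G) hf

theorem LipB.sub {f g : E → G} (hf : LipB S f) (hg : LipB S g) : LipB S (fun x => f x - g x) := by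
  have := hf.add (hg.smul_const (-1))
  simpa [sub_eq_add_neg] using this

theorem LipB.comp_lip {L : ℝ≥0} {h : G → H} (hh : LipschitzWith L h) {f : E → G} (hf : LipB S f) :
    LipB S (fun x => h (f x)) := by
  obtain ⟨C, hC, h1, h2⟩ := hf
  refine ⟨L * C + ‖h 0‖, by positivity, fun x hx => ?_, fun x hx y hy => ?_⟩
  · have := hh.dist_le_mul (f x) 0
    rw [dist_eq_norm, dist_zero_right] at this
    have h5 : ‖h (f x)‖ ≤ ‖h (f x) - h 0‖ + ‖h 0‖ := by
      simpa using norm_add_le (h (f x) - h 0) (h 0)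
    have h6 : (L : ℝ) * ‖f x‖ ≤ L * C := by gcongr; exact h1 x hx
    linarith
  · have := hh.dist_le_mul (f x) (f y)
    rw [dist_eq_norm, dist_eq_norm] at this
    have h6 : (L : ℝ) * ‖f x - f y‖ ≤ L * (C * ‖x - y‖) := by gcongr; exact h2 x hx y hy
    have : 0 ≤ ‖h 0‖ * ‖x - y‖ := by positivity
    linarith

theorem LipB.fix {B : E → G →L[ℝ] G} {c w : E → G} (hB : LipB S B) (hc : LipB S c) {κ : ℝ}
    (hκ : κ < 1) (hBκ : ∀ x ∈ S, ‖B x‖ ≤ κ) (hw : ∀ x ∈ S, w x = B x (w x) + c x) : LipB S w := by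
  obtain ⟨C, hC, h1, h2⟩ := hB
  obtain ⟨D, hD, h3, h4⟩ := hc
  have h5 : ∀ x ∈ S, ‖w x‖ ≤ D / (1 - κ) := by
    intro x hx
    rw [le_div_iff₀ (by linarith)]
    have : ‖w x‖ ≤ κ * ‖w x‖ + D := by
      conv_lhs => rw [hw x hx]
      refine (norm_add_le _ _).trans (add_le_add ?_ (h3 x hx))
      exact (B x).le_of_opNorm_le (hBκ x hx) _
    linarith
  have hM : 0 ≤ D / (1 - κ) := div_nonneg hD (by linarith)
  have hN : 0 ≤ (C * (D / (1 - κ)) + D) / (1 - κ) := div_nonneg (by positivity) (by linarith)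
  refine ⟨D / (1 - κ) + (C * (D / (1 - κ)) + D) / (1 - κ), by positivity,
    fun x hx => by linarith [h5 x hx], fun x hx y hy => ?_⟩
  have h6 : ‖w x - w y‖ ≤ κ * ‖w x - w y‖ + C * ‖x - y‖ * (D / (1 - κ)) + D * ‖x - y‖ := by
    have e : w x - w y = B x (w x - w y) + (B x - B y) (w y) + (c x - c y) := by
      conv_lhs => rw [hw x hx, hw y hy]
      simp; abel
    conv_lhs => rw [e]
    refine (norm_add_le _ _).trans (add_le_add ((norm_add_le _ _).trans (add_le_add ?_ ?_))
      (h4 x hx y hy))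
    · exact (B x).le_of_opNorm_le (hBκ x hx) _
    · refine ((B x - B y).le_opNorm _).trans ?_
      gcongr
      exacts [h2 x hx y hy, h5 y hy]
  have h7 : ‖w x - w y‖ ≤ (C * (D / (1 - κ)) + D) / (1 - κ) * ‖x - y‖ := by
    rw [div_mul_eq_mul_div, le_div_iff₀ (by linarith)]
    linarith
  have : 0 ≤ D / (1 - κ) * ‖x - y‖ := by positivity
  linarith

theorem LipB.lipschitzOnWith {f : E → G} (hf : LipB S f) : ∃ K : ℝ≥0, LipschitzOnWith K f S := by
  obtain ⟨C, hC, h1, h2⟩ := hf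
  refine ⟨⟨C, hC⟩, LipschitzOnWith.of_dist_le_mul fun x hx y hy => ?_⟩
  rw [dist_eq_norm, dist_eq_norm]
  exact h2 x hx y hy

end LipBsec

/-- global existence for bounded Lipschitz vector fields -/
theorem exists_global_curve {E : Type*} [NormedAddCommGroup E] [NormedSpace ℝ E] [CompleteSpace E]
    (f : E → E) (hf : LipB univ f) (x₀ : E) :
    ∃ g : ℝ → E, g 0 = x₀ ∧ ∀ t, HasDerivAt g (f (g t)) t := by
  obtain ⟨K, hK⟩ := hf.lipschitzOnWith
  obtain ⟨C, hC, h1, h2⟩ := hf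
  lift C to ℝ≥0 using hC
  have hex : ∀ N : ℕ, ∃ α : ℝ → E, α 0 = x₀ ∧
      ∀ t ∈ Ioo (-(N + 1 : ℝ)) (N + 1), HasDerivAt α (f (α t)) t := by
    intro N
    have hN : (0 : ℝ) ≤ N := by positivity
    have h0 : (0 : ℝ) ∈ Icc (-(N + 1 : ℝ)) (N + 1) := ⟨by linarith, by linarith⟩
    have hPL : IsPicardLindelof (fun _ => f) (⟨0, h0⟩ : Icc (-(N + 1 : ℝ)) (N + 1)) x₀
        (C * (N + 1)) 0 C K := by
      refine IsPicardLindelof.of_time_independent (fun x _ => h1 x (mem_univ _))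
        (hK.mono (subset_univ _)) ?_
      simp
    obtain ⟨α, hα0, hα⟩ := hPL.exists_eq_forall_mem_Icc_hasDerivWithinAt₀
    exact ⟨α, hα0, fun t ht => (hα t (Ioo_subset_Icc_self ht)).hasDerivAt (Icc_mem_nhds ht.1 ht.2)⟩
  choose α hα0 hα using hex
  have huniq : ∀ N M : ℕ, N ≤ M → EqOn (α N) (α M) (Ioo (-(N + 1 : ℝ)) (N + 1)) := by
    intro N M hNM
    have hN : (0 : ℝ) ≤ N := by positivity
    have hNM' : (N : ℝ) ≤ M := by exact_mod_cast hNM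
    refine ODE_solution_unique_of_mem_Ioo (v := fun _ => f) (s := fun _ => univ) (K := K) (t₀ := 0)
      (fun _ _ => hK) ⟨by linarith, by linarith⟩ (fun t ht => ⟨hα N t ht, mem_univ _⟩)
      (fun t ht => ⟨hα M t ⟨by linarith [ht.1], by linarith [ht.2]⟩, mem_univ _⟩) ?_
    rw [hα0, hα0]
  refine ⟨fun t => α ⌈|t|⌉₊ t, by simp [hα0], fun t => ?_⟩
  have key : ∀ N : ℕ, ∀ s ∈ Ioo (-(N + 1 : ℝ)) (N + 1), α ⌈|s|⌉₊ s = α N s := by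
    intro N s hs
    have hs' : s ∈ Ioo (-((⌈|s|⌉₊ : ℕ) + 1 : ℝ)) ((⌈|s|⌉₊ : ℕ) + 1) := by
      have := Nat.le_ceil |s|
      exact abs_lt.1 (by linarith)
    rcases le_total N ⌈|s|⌉₊ with h | h
    · exact (huniq _ _ h hs).symm
    · exact huniq _ _ h hs'
  have ht : t ∈ Ioo (-((⌈|t|⌉₊ : ℕ) + 1 : ℝ)) ((⌈|t|⌉₊ : ℕ) + 1) := by
    have := Nat.le_ceil |t|
    exact abs_lt.1 (by linarith)
  refine (hα _ t ht).congr_of_eventuallyEq ?_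
  filter_upwards [Ioo_mem_nhds ht.1 ht.2] with s hs
  exact key _ s hs

/-- uniqueness by continuous induction -/
theorem unique_curve {E : Type*} [NormedAddCommGroup E] [NormedSpace ℝ E]
    (f : E → E) (S : Set E) (hf : LipB S f) (u v D : ℝ → E)
    (hu : ∀ t ∈ Ici (0 : ℝ), HasDerivWithinAt u (f (u t)) (Ici 0) t)
    (huS : ∀ t ∈ Ici (0 : ℝ), S ∈ 𝓝 (u t))
    (hv : ∀ t ∈ Ici (0 : ℝ), HasDerivWithinAt v (D t) (Ici 0) t)
    (hvD : ∀ t ∈ Ici (0 : ℝ), v t ∈ S → D t = f (v t)) (h0 : v 0 = u 0) :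
    ∀ t ∈ Ici (0 : ℝ), v t = u t := by
  obtain ⟨K, hK⟩ := hf.lipschitzOnWith
  have huc : ContinuousOn u (Ici 0) := fun t ht => (hu t ht).continuousWithinAt
  have hvc : ContinuousOn v (Ici 0) := fun t ht => (hv t ht).continuousWithinAt
  intro T hT
  have hsub : Icc 0 T ⊆ {t | v t = u t} := by
    refine IsClosed.Icc_subset_of_forall_exists_gt ?_ h0 ?_
    · have : {t | v t = u t} ∩ Icc 0 T = Icc 0 T ∩ (fun t => v t - u t) ⁻¹' {0} := by
        ext t; simp [sub_eq_zero, and_comm]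
      rw [this]
      exact ((hvc.sub huc).mono Icc_subset_Ici_self).preimage_isClosed_of_isClosed isClosed_Icc
        isClosed_singleton
    · rintro x ⟨hx, hx0, hxT⟩ y hy
      have hx' : v x = u x := hx
      have e1 : ∀ᶠ t in 𝓝[Ici x] x, u t ∈ S :=
        ((huc x hx0).mono (Ici_subset_Ici.2 hx0)).eventually (huS x hx0)
      have e2 : ∀ᶠ t in 𝓝[Ici x] x, v t ∈ S :=
        ((hvc x hx0).mono (Ici_subset_Ici.2 hx0)).eventually (by rw [hx']; exact huS x hx0)
      obtain ⟨z, hz, hzS⟩ := (mem_nhdsGE_iff_exists_Ico_subset).1 (e1.and e2)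
      have hz : x < z := hz
      have hy : x < y := hy
      obtain ⟨w, hw1, hw2⟩ := exists_between (lt_min hz hy)
      have hsub2 : Icc x w ⊆ Ici 0 := fun t ht => le_trans hx0 ht.1
      have hsubI : ∀ t ∈ Ico x w, Ici t ⊆ Ici (0 : ℝ) := fun t ht =>
        Ici_subset_Ici.2 (hsub2 (Ico_subset_Icc_self ht))
      have hmem : ∀ t ∈ Ico x w, t ∈ Ico x z := fun t ht =>
        ⟨ht.1, ht.2.trans (hw2.trans_le (min_le_left _ _))⟩
      have := ODE_solution_unique_of_mem_Icc_right (v := fun _ => f) (s := fun _ => S) (K := K)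
        (a := x) (b := w) (f := v) (g := u) (fun _ _ => hK) (hvc.mono hsub2)
        (fun t ht => by
          have h3 := hsub2 (Ico_subset_Icc_self ht)
          have := hvD t h3 (hzS (hmem t ht)).2
          rw [← this]
          exact (hv t h3).mono (hsubI t ht))
        (fun t ht => (hzS (hmem t ht)).2) (huc.mono hsub2)
        (fun t ht => (hu t (hsub2 (Ico_subset_Icc_self ht))).mono (hsubI t ht))
        (fun t ht => (hzS (hmem t ht)).1) hx'
      exact ⟨w, this ⟨hw1.le, le_rfl⟩, hw1, hw2.le.trans (min_le_right _ _)⟩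
  exact hsub ⟨hT, le_rfl⟩

section ops
variable {n : ℕ} (ν : Measure (Fin n → ℝ))

theorem integrable_mul_bcf (g : (Fin n → ℝ) →ᵇ ℝ) (f : Lp ℝ 1 ν) :
    Integrable (fun x => g x * f x) ν :=
  (L1.integrable_coeFn f).bdd_mul (c := ‖g‖) g.continuous.aestronglyMeasurable
    (Filter.Eventually.of_forall fun x => g.norm_coe_le_norm x)

/-- multiplication of an integrable function by a bounded continuous one -/
noncomputable def mulL : ((Fin n → ℝ) →ᵇ ℝ) →L[ℝ] Lp ℝ 1 ν →L[ℝ] Lp ℝ 1 ν :=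
  LinearMap.mkContinuous₂
    (LinearMap.mk₂ ℝ (fun g f => (integrable_mul_bcf ν g f).toL1 _)
      (by
        intro g g' f
        rw [← Integrable.toL1_add]
        congr 1; ext x; simp [add_mul])
      (by
        intro c g f
        rw [← Integrable.toL1_smul]
        congr 1; ext x; simp [mul_assoc])
      (by
        intro g f f'
        rw [← Integrable.toL1_add, Integrable.toL1_eq_toL1_iff]
        filter_upwards [Lp.coeFn_add f f'] with x hx
        simp only [hx, Pi.add_apply, mul_add])
      (by
        intro c g f
        rw [← Integrable.toL1_smul, Integrable.toL1_eq_toL1_iff]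
        filter_upwards [Lp.coeFn_smul c f] with x hx
        simp [hx]; ring)) 1
    (by
      intro g f
      simp only [LinearMap.mk₂_apply]
      rw [one_mul, L1.norm_eq_integral_norm, L1.norm_eq_integral_norm, ← integral_const_mul]
      refine integral_mono_ae (L1.integrable_coeFn _).norm
        ((L1.integrable_coeFn f).norm.const_mul _) ?_
      filter_upwards [(integrable_mul_bcf ν g f).coeFn_toL1] with x hx
      simp only [hx, norm_mul]
      gcongr
      exact g.norm_coe_le_norm x)

theorem mulL_coe (g : (Fin n → ℝ) →ᵇ ℝ) (f : Lp ℝ 1 ν) :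
    (mulL ν g f : (Fin n → ℝ) → ℝ) =ᵐ[ν] fun x => g x * f x :=
  (integrable_mul_bcf ν g f).coeFn_toL1

theorem mulL_norm_le : ‖mulL (n := n) ν‖ ≤ 1 :=
  LinearMap.mkContinuous₂_norm_le _ zero_le_one _

theorem mulL_norm (g : (Fin n → ℝ) →ᵇ ℝ) (f : Lp ℝ 1 ν) : ‖mulL ν g f‖ ≤ ‖g‖ * ‖f‖ := by
  have := (mulL ν).le_opNorm₂ g f
  have h : ‖mulL ν‖ * ‖g‖ * ‖f‖ ≤ 1 * ‖g‖ * ‖f‖ := by gcongr; exact mulL_norm_le ν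
  linarith

theorem mulL_mul (g h : (Fin n → ℝ) →ᵇ ℝ) (f : Lp ℝ 1 ν) :
    mulL ν (g * h) f = mulL ν g (mulL ν h f) := by
  apply Lp.ext
  filter_upwards [mulL_coe ν (g * h) f, mulL_coe ν g (mulL ν h f), mulL_coe ν h f] with x h1 h2 h3
  rw [h1, h2, h3]; simp [mul_assoc]

theorem k_norm_le (k : C((Fin n → ℝ) × (Fin n → ℝ), ℝ)) (k0 k1 : ℝ) (hk0 : 0 < k0)
    (hk : ∀ p, k p ∈ Icc k0 k1)
    (p) : ‖k p‖ ≤ k1 := by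
  rw [Real.norm_eq_abs, abs_of_pos (hk0.trans_le (hk p).1)]; exact (hk p).2

theorem integrable_mul_k (k : C((Fin n → ℝ) × (Fin n → ℝ), ℝ)) (k0 k1 : ℝ) (hk0 : 0 < k0)
    (hk : ∀ p, k p ∈ Icc k0 k1)
    {f : (Fin n → ℝ) → ℝ} (hf : Integrable f ν) (x : Fin n → ℝ) :
    Integrable (fun y => f y * k (x, y)) ν :=
  hf.mul_bdd (c := k1) (by fun_prop : Continuous fun y => k (x, y)).aestronglyMeasurable
    (Filter.Eventually.of_forall fun y => k_norm_le k k0 k1 hk0 hk _)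

theorem norm_int_k_le (k : C((Fin n → ℝ) × (Fin n → ℝ), ℝ)) (k0 k1 : ℝ) (hk0 : 0 < k0)
    (hk : ∀ p, k p ∈ Icc k0 k1)
    (f : Lp ℝ 1 ν) (x : Fin n → ℝ) :
    ‖∫ y, f y * k (x, y) ∂ν‖ ≤ k1 * ‖f‖ := by
  refine (norm_integral_le_integral_norm _).trans ?_
  rw [L1.norm_eq_integral_norm, ← integral_const_mul]
  refine integral_mono (integrable_mul_k ν k k0 k1 hk0 hk (L1.integrable_coeFn f) x).norm
    ((L1.integrable_coeFn f).norm.const_mul _) fun y => ?_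
  simp only [norm_mul]
  rw [mul_comm]
  gcongr
  exact k_norm_le k k0 k1 hk0 hk _

variable (k : C((Fin n → ℝ) × (Fin n → ℝ), ℝ)) (k0 k1 : ℝ) (hk0 : 0 < k0)
  (hk : ∀ p, k p ∈ Icc k0 k1)

/-- integral operator -/
noncomputable def KL : Lp ℝ 1 ν →L[ℝ] ((Fin n → ℝ) →ᵇ ℝ) :=
  LinearMap.mkContinuous
    { toFun := fun f => BoundedContinuousFunction.ofNormedAddCommGroup
        (fun x => ∫ y, f y * k (x, y) ∂ν)
        (by
          refine continuous_of_dominated (bound := fun y => k1 * ‖f y‖)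
            (fun x => (integrable_mul_k ν k k0 k1 hk0 hk (L1.integrable_coeFn f) x).1)
            (fun x => Filter.Eventually.of_forall fun y => ?_)
            ((L1.integrable_coeFn f).norm.const_mul _)
            (Filter.Eventually.of_forall fun y => by fun_prop)
          rw [norm_mul, mul_comm]
          gcongr
          exact k_norm_le k k0 k1 hk0 hk _)
        (k1 * ‖f‖) (norm_int_k_le ν k k0 k1 hk0 hk f)
      map_add' := by
        intro f g
        ext x
        simp only [BoundedContinuousFunction.coe_ofNormedAddCommGroup,
          BoundedContinuousFunction.coe_add, Pi.add_apply]
        rw [← integral_add (integrable_mul_k ν k k0 k1 hk0 hk (L1.integrable_coeFn f) x)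
          (integrable_mul_k ν k k0 k1 hk0 hk (L1.integrable_coeFn g) x)]
        apply integral_congr_ae
        filter_upwards [Lp.coeFn_add f g] with y hy
        simp only [hy, Pi.add_apply, add_mul]
      map_smul' := by
        intro c f
        ext x
        simp only [BoundedContinuousFunction.coe_ofNormedAddCommGroup,
          BoundedContinuousFunction.coe_smul, RingHom.id_apply, smul_eq_mul]
        rw [← integral_const_mul]
        apply integral_congr_ae
        filter_upwards [Lp.coeFn_smul c f] with y hy
        simp [hy, mul_assoc] }
    k1 (fun f => BoundedContinuousFunction.norm_ofNormedAddCommGroup_le _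
      (mul_nonneg (hk0.le.trans ((hk 0).1.trans (hk 0).2)) (norm_nonneg _)) (norm_int_k_le ν k k0 k1 hk0 hk f))

theorem KL_apply (f : Lp ℝ 1 ν) (x : Fin n → ℝ) :
    KL ν k k0 k1 hk0 hk f x = ∫ y, f y * k (x, y) ∂ν := rfl

theorem KL_norm (f : Lp ℝ 1 ν) : ‖KL ν k k0 k1 hk0 hk f‖ ≤ k1 * ‖f‖ :=
  BoundedContinuousFunction.norm_ofNormedAddCommGroup_le _
      (mul_nonneg (hk0.le.trans ((hk 0).1.trans (hk 0).2)) (norm_nonneg _)) (norm_int_k_le ν k k0 k1 hk0 hk f)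

theorem KL_nonneg (f : Lp ℝ 1 ν) (hf : ∀ᵐ x ∂ν, 0 ≤ f x) (x : Fin n → ℝ) :
    0 ≤ KL ν k k0 k1 hk0 hk f x := by
  rw [KL_apply]
  apply integral_nonneg_of_ae
  filter_upwards [hf] with y hy
  exact mul_nonneg hy (hk0.le.trans (hk _).1)

theorem KL_lower (f : Lp ℝ 1 ν) (hf : ∀ᵐ x ∂ν, 0 ≤ f x) (x : Fin n → ℝ) :
    k0 * ‖f‖ ≤ KL ν k k0 k1 hk0 hk f x := by
  rw [KL_apply, L1.norm_eq_integral_norm, ← integral_const_mul]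
  refine integral_mono_ae ((L1.integrable_coeFn f).norm.const_mul _)
    (integrable_mul_k ν k k0 k1 hk0 hk (L1.integrable_coeFn f) x) ?_
  filter_upwards [hf] with y hy
  simp only [Real.norm_eq_abs, abs_of_nonneg hy]
  rw [mul_comm]
  gcongr
  exact (hk _).1

/-- integration as a functional -/
theorem int_eq (f : Lp ℝ 1 ν) : L1.integralCLM f = ∫ x, f x ∂ν := by
  rw [← L1.integral_eq, L1.integral_eq_integral]

end ops

section core
variable {n : ℕ} (ν : Measure (Fin n → ℝ))

theorem exists_lip_ext (a0 a1 : ℝ) (h : ℝ → ℝ) (hh : ContDiffOn ℝ 1 h (Icc a0 a1)) :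
    ∃ g : ℝ → ℝ, (∃ K : ℝ≥0, LipschitzWith K g) ∧ EqOn h g (Icc a0 a1) := by
  obtain ⟨K, hK⟩ := hh.exists_lipschitzOnWith one_ne_zero (convex_Icc _ _) isCompact_Icc
  obtain ⟨g, hg, he⟩ := hK.extend_real
  exact ⟨g, ⟨K, hg⟩, he⟩

theorem lp_abs_nonneg (f : Lp ℝ 1 ν) : ∀ᵐ x ∂ν, 0 ≤ (|f| : Lp ℝ 1 ν) x := by
  filter_upwards [Lp.coeFn_abs f] with x hx
  rw [hx]; exact abs_nonneg _

/-- annulus -/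
def annu (Λ : ℝ) : Set (Lp ℝ 1 ν) := {f | Λ / 2 ≤ ‖f‖ ∧ ‖f‖ ≤ 2 * Λ}

theorem LipB_id {Λ : ℝ} (hΛ : 0 < Λ) : LipB (annu ν Λ) (fun f => f) :=
  ⟨2 * Λ + 1, by positivity, fun f hf => by linarith [hf.2], fun x _ y _ => by
    have : 0 ≤ 2 * Λ * ‖x - y‖ := by positivity
    linarith⟩

theorem LipB_abs {Λ : ℝ} (hΛ : 0 < Λ) : LipB (annu ν Λ) (fun f => |f|) :=
  ⟨2 * Λ + 1, by positivity, fun f hf => by rw [norm_abs_eq_norm]; linarith [hf.2],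
    fun x _ y _ => by
    have : 0 ≤ 2 * Λ * ‖x - y‖ := by positivity
    have := norm_abs_sub_abs x y
    linarith⟩

variable (k : C((Fin n → ℝ) × (Fin n → ℝ), ℝ)) (k0 k1 : ℝ) (hk0 : 0 < k0)
  (hk : ∀ p, k p ∈ Icc k0 k1)

/-- the price aggregate -/
noncomputable def Aop (F : ℝ) (f : Lp ℝ 1 ν) : (Fin n → ℝ) →ᵇ ℝ :=
  (1 / F) • KL ν k k0 k1 hk0 hk |f|

theorem Aop_mem {F : ℝ} (hF : 0 < F) (f : Lp ℝ 1 ν) (x : Fin n → ℝ) :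
    Aop ν k k0 k1 hk0 hk F f x ∈ Icc (k0 * ‖f‖ / F) (k1 * ‖f‖ / F) := by
  have h1 := KL_lower ν k k0 k1 hk0 hk |f| (lp_abs_nonneg ν f) x
  have h2 := (BoundedContinuousFunction.norm_coe_le_norm _ x).trans
    (KL_norm ν k k0 k1 hk0 hk |f|)
  rw [norm_abs_eq_norm] at h1 h2
  have h3 := (le_abs_self _).trans h2
  have e : Aop ν k k0 k1 hk0 hk F f x = KL ν k k0 k1 hk0 hk |f| x / F := by
    simp [Aop, div_eq_inv_mul]
  rw [e]
  exact ⟨by gcongr, by gcongr⟩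

theorem core_wage (F σ μ Λ p : ℝ) (hF : 0 < F) (hσ : 0 < σ) (hμ : 0 < μ) (hΛ : 0 < Λ)
    (hκ : μ / σ * (k1 / k0) < 1) (φ : Lp ℝ 1 ν) (hφ : ∀ᵐ x ∂ν, 0 ≤ φ x) :
    ∃ iA rp w : Lp ℝ 1 ν → ((Fin n → ℝ) →ᵇ ℝ),
      LipB (annu ν Λ) rp ∧ LipB (annu ν Λ) w ∧ ∀ f ∈ annu ν Λ,
        (∀ x, iA f x = (Aop ν k k0 k1 hk0 hk F f x)⁻¹) ∧
        (∀ x, rp f x = (Aop ν k k0 k1 hk0 hk F f x) ^ p) ∧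
        (∀ x, 0 ≤ w f x) ∧
        (w f = (μ / (σ * F)) • KL ν k k0 k1 hk0 hk (mulL ν (iA f) (mulL ν (w f) |f| + φ))) ∧
        ∀ w', w' = (μ / (σ * F)) • KL ν k k0 k1 hk0 hk (mulL ν (iA f) (mulL ν w' |f| + φ)) →
          w' = w f := by
  have hk1 : 0 < k1 := hk0.trans_le ((hk 0).1.trans (hk 0).2)
  set a0 := k0 * (Λ / 2) / F with ha0
  set a1 := k1 * (2 * Λ) / F with ha1
  have ha0p : 0 < a0 := by positivity
  obtain ⟨hi, ⟨Ki, hKi⟩, hieq⟩ := exists_lip_ext a0 a1 (fun t => t⁻¹)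
    (fun t ht => (contDiffAt_inv ℝ (ne_of_gt (ha0p.trans_le ht.1))).contDiffWithinAt)
  obtain ⟨hp, ⟨Kp, hKp⟩, hpeq⟩ := exists_lip_ext a0 a1 (fun t => t ^ p)
    (fun t ht => (Real.contDiffAt_rpow_const_of_ne
      (ne_of_gt (ha0p.trans_le ht.1))).contDiffWithinAt)
  have hA : ∀ f ∈ annu ν Λ, ∀ x, Aop ν k k0 k1 hk0 hk F f x ∈ Icc a0 a1 := by
    intro f hf x
    have h := Aop_mem ν k k0 k1 hk0 hk hF f x
    refine ⟨le_trans ?_ h.1, h.2.trans ?_⟩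
    · rw [ha0]; have := hf.1; gcongr
    · rw [ha1]; have := hf.2; gcongr
  have hAL : LipB (annu ν Λ) (Aop ν k k0 k1 hk0 hk F) :=
    ((LipB_abs ν hΛ).clm (KL ν k k0 k1 hk0 hk)).smul_const (1 / F)
  set iA : Lp ℝ 1 ν → ((Fin n → ℝ) →ᵇ ℝ) := fun f =>
    BoundedContinuousFunction.comp hi hKi (Aop ν k k0 k1 hk0 hk F f) with hiA
  set rp : Lp ℝ 1 ν → ((Fin n → ℝ) →ᵇ ℝ) := fun f =>
    BoundedContinuousFunction.comp hp hKp (Aop ν k k0 k1 hk0 hk F f) with hrp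
  have hiAL : LipB (annu ν Λ) iA := hAL.comp_lip (BoundedContinuousFunction.lipschitz_comp hKi)
  have hrpL : LipB (annu ν Λ) rp := hAL.comp_lip (BoundedContinuousFunction.lipschitz_comp hKp)
  have hiAx : ∀ f ∈ annu ν Λ, ∀ x, iA f x = (Aop ν k k0 k1 hk0 hk F f x)⁻¹ :=
    fun f hf x => (hieq (hA f hf x)).symm
  have hrpx : ∀ f ∈ annu ν Λ, ∀ x, rp f x = (Aop ν k k0 k1 hk0 hk F f x) ^ p :=
    fun f hf x => (hpeq (hA f hf x)).symm
  -- the linear operators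
  set c := μ / (σ * F) with hc
  have hcpos : 0 < c := by positivity
  set K := KL ν k k0 k1 hk0 hk with hK
  set B : Lp ℝ 1 ν → ((Fin n → ℝ) →ᵇ ℝ) →L[ℝ] ((Fin n → ℝ) →ᵇ ℝ) := fun f =>
    c • (K.comp ((mulL ν (iA f)).comp ((mulL ν).flip |f|))) with hB
  set d : Lp ℝ 1 ν → ((Fin n → ℝ) →ᵇ ℝ) := fun f => c • K (mulL ν (iA f) φ) with hd
  have hBL : LipB (annu ν Λ) B := by
    have h1 : LipB (annu ν Λ) (fun f => (mulL ν (iA f)).comp ((mulL ν).flip |f|)) := by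
      have ha := LipB.clm (H := Lp ℝ 1 ν →L[ℝ] Lp ℝ 1 ν) (mulL ν) hiAL
      have hb := LipB.clm (H := ((Fin n → ℝ) →ᵇ ℝ) →L[ℝ] Lp ℝ 1 ν) ((mulL ν).flip) (LipB_abs ν hΛ)
      have := LipB.bilin (I := ((Fin n → ℝ) →ᵇ ℝ) →L[ℝ] Lp ℝ 1 ν)
        (ContinuousLinearMap.compL ℝ ((Fin n → ℝ) →ᵇ ℝ) (Lp ℝ 1 ν) (Lp ℝ 1 ν)) ha hb
      exact this
    have h2 := LipB.clm (H := ((Fin n → ℝ) →ᵇ ℝ) →L[ℝ] ((Fin n → ℝ) →ᵇ ℝ))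
      (ContinuousLinearMap.compL ℝ ((Fin n → ℝ) →ᵇ ℝ) _ _ K) h1
    exact h2.smul_const c
  have hdL : LipB (annu ν Λ) d :=
    ((hiAL.bilin (mulL ν) (LipB.const φ)).clm K).smul_const c
  set κ := μ / σ * (k1 / k0) with hκd
  have hκ0 : 0 ≤ κ := by positivity
  have hBκ : ∀ f ∈ annu ν Λ, ‖B f‖ ≤ κ := by
    intro f hf
    have hfp : 0 < ‖f‖ := by have := hf.1; linarith
    have hiAn : ‖iA f‖ ≤ F / (k0 * ‖f‖) := by
      rw [BoundedContinuousFunction.norm_le (by positivity)]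
      intro x
      rw [hiAx f hf x]
      have := (Aop_mem ν k k0 k1 hk0 hk hF f x).1
      have hq : 0 < k0 * ‖f‖ / F := by positivity
      rw [Real.norm_eq_abs, abs_of_pos (inv_pos.2 (hq.trans_le this)),
        ← inv_div]
      gcongr
    refine ContinuousLinearMap.opNorm_le_bound _ hκ0 fun g => ?_
    have e : B f g = c • K (mulL ν (iA f) (mulL ν g |f|)) := rfl
    rw [e, norm_smul, Real.norm_eq_abs, abs_of_pos hcpos]
    have s1 : ‖K (mulL ν (iA f) (mulL ν g |f|))‖ ≤ k1 * (F / (k0 * ‖f‖) * (‖g‖ * ‖f‖)) := by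
      refine (KL_norm ν k k0 k1 hk0 hk _).trans ?_
      gcongr
      refine (mulL_norm ν _ _).trans ?_
      gcongr
      refine (mulL_norm ν _ _).trans ?_
      rw [norm_abs_eq_norm]
    calc c * _ ≤ c * (k1 * (F / (k0 * ‖f‖) * (‖g‖ * ‖f‖))) := by gcongr
      _ = κ * ‖g‖ := by rw [hc, hκd]; field_simp
  have heq : ∀ f g, c • K (mulL ν (iA f) (mulL ν g |f| + φ)) = B f g + d f := by
    intro f g
    simp [hB, hd, map_add]
  have hex : ∀ f, ∃ g : (Fin n → ℝ) →ᵇ ℝ, f ∈ annu ν Λ → (∀ x, 0 ≤ g x) ∧ g = B f g + d f := by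
    intro f
    by_cases hf : f ∈ annu ν Λ
    swap
    · exact ⟨0, fun h => absurd h hf⟩
    set s : Set ((Fin n → ℝ) →ᵇ ℝ) := {g | ∀ x, 0 ≤ g x} with hs
    have hsc : IsClosed s := by
      have : s = ⋂ x, {g : (Fin n → ℝ) →ᵇ ℝ | 0 ≤ g x} := by ext; simp [hs]
      rw [this]
      exact isClosed_iInter fun x => isClosed_le continuous_const
        (continuous_eval_const x)
    have hmaps : MapsTo (fun g => B f g + d f) s s := by
      intro g hg x
      change 0 ≤ (B f g + d f) x
      rw [← heq]
      change 0 ≤ c * K _ x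
      refine mul_nonneg hcpos.le (KL_nonneg ν k k0 k1 hk0 hk _ ?_ x)
      filter_upwards [mulL_coe ν (iA f) (mulL ν g |f| + φ), Lp.coeFn_add (mulL ν g |f|) φ,
        mulL_coe ν g |f|, lp_abs_nonneg ν f, hφ] with y h1 h2 h3 h4 h5
      rw [h1, h2, Pi.add_apply, h3]
      refine mul_nonneg ?_ (add_nonneg (mul_nonneg (hg y) h4) h5)
      rw [hiAx f hf y]
      exact inv_nonneg.2 (ha0p.le.trans (hA f hf y).1)
    have hcontr : ContractingWith ⟨κ, hκ0⟩ (hmaps.restrict (fun g => B f g + d f) s s) := by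
      refine ⟨by exact_mod_cast hκ, LipschitzWith.of_dist_le_mul fun g h => ?_⟩
      change dist (B f g + d f) (B f h + d f) ≤ κ * dist (g : (Fin n → ℝ) →ᵇ ℝ) h
      rw [dist_add_right, dist_eq_norm, dist_eq_norm, ← map_sub]
      exact (B f).le_of_opNorm_le (hBκ f hf) _
    obtain ⟨y, hys, hy, -⟩ := ContractingWith.exists_fixedPoint' hsc.isComplete hmaps hcontr
      (x := 0) (fun x => le_rfl) (edist_ne_top _ _)
    exact ⟨y, fun _ => ⟨hys, hy.symm⟩⟩
  choose w hw using hex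
  refine ⟨iA, rp, w, hrpL, hBL.fix hdL hκ hBκ (fun f hf => (hw f hf).2), fun f hf =>
    ⟨hiAx f hf, hrpx f hf, (hw f hf).1, ?_, fun w' hw' => ?_⟩⟩
  · rw [heq]; exact (hw f hf).2
  · rw [heq] at hw'
    have e : w' - w f = B f (w' - w f) := by
      conv_lhs => rw [hw', (hw f hf).2]
      simp
    have h1 : ‖w' - w f‖ ≤ κ * ‖w' - w f‖ := by
      conv_lhs => rw [e]
      exact (B f).le_of_opNorm_le (hBκ f hf) _
    have h2 : ‖w' - w f‖ = 0 := by
      have := norm_nonneg (w' - w f)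
      nlinarith
    exact sub_eq_zero.1 (norm_eq_zero.1 h2)

end core

section dyn
variable {n : ℕ} (ν : Measure (Fin n → ℝ))

/-- the integral functional -/
noncomputable def IL : Lp ℝ 1 ν →L[ℝ] ℝ := L1.integralCLM

theorem IL_apply (f : Lp ℝ 1 ν) : IL ν f = ∫ x, f x ∂ν := int_eq ν f

theorem IL_abs_le (f : Lp ℝ 1 ν) : |IL ν f| ≤ ‖f‖ := by
  rw [IL_apply, L1.norm_eq_integral_norm]
  exact norm_integral_le_integral_norm (f : (Fin n → ℝ) → ℝ)

theorem IL_eq_norm (f : Lp ℝ 1 ν) (hf : ∀ᵐ x ∂ν, 0 ≤ f x) : IL ν f = ‖f‖ := by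
  rw [IL_apply, L1.norm_eq_integral_norm]
  apply integral_congr_ae
  filter_upwards [hf] with x hx
  rw [Real.norm_eq_abs, abs_of_nonneg hx]

/-- the replicator derivative -/
noncomputable def JL (Λ : ℝ) (f : Lp ℝ 1 ν) : ((Fin n → ℝ) →ᵇ ℝ) →L[ℝ] Lp ℝ 1 ν :=
  (mulL ν).flip f - (1 / Λ) • ((IL ν).comp ((mulL ν).flip f)).smulRight f

theorem JL_apply (Λ : ℝ) (f : Lp ℝ 1 ν) (g : (Fin n → ℝ) →ᵇ ℝ) :
    JL ν Λ f g = mulL ν g f - ((1 / Λ) * IL ν (mulL ν g f)) • f := by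
  simp [JL, mul_smul]

theorem JL_norm {Λ : ℝ} (hΛ : 0 < Λ) (f : Lp ℝ 1 ν) (hf : ‖f‖ = Λ) : ‖JL ν Λ f‖ ≤ 2 * Λ := by
  refine ContinuousLinearMap.opNorm_le_bound _ (by positivity) fun g => ?_
  rw [JL_apply]
  have h1 := mulL_norm ν g f
  have h2 := (IL_abs_le ν (mulL ν g f)).trans h1
  refine (norm_sub_le _ _).trans ?_
  rw [norm_smul, norm_mul, Real.norm_eq_abs, Real.norm_eq_abs, abs_of_pos (by positivity : 0 < 1 / Λ)]
  rw [hf] at *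
  calc _ ≤ ‖g‖ * Λ + 1 / Λ * (‖g‖ * Λ) * Λ := by gcongr
    _ = _ := by field_simp; ring

theorem bcf_exp_apply (g : (Fin n → ℝ) →ᵇ ℝ) (x : Fin n → ℝ) :
    (NormedSpace.exp g : (Fin n → ℝ) →ᵇ ℝ) x = Real.exp (g x) := by
  let ev : ((Fin n → ℝ) →ᵇ ℝ) →+* ℝ :=
    { toFun := fun g => g x, map_one' := rfl, map_mul' := fun _ _ => rfl, map_zero' := rfl,
      map_add' := fun _ _ => rfl }
  have := NormedSpace.map_exp ev (continuous_eval_const x) g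
  rw [Real.exp_eq_exp_ℝ]
  exact this

variable (Λ : ℝ) (l : Lp ℝ 1 ν)

/-- unnormalised density -/
noncomputable def Pg (g : (Fin n → ℝ) →ᵇ ℝ) : Lp ℝ 1 ν := mulL ν (NormedSpace.exp g) l

/-- normalised density -/
noncomputable def Ug (g : (Fin n → ℝ) →ᵇ ℝ) : Lp ℝ 1 ν := (Λ * (IL ν (Pg ν l g))⁻¹) • Pg ν l g

theorem Pg_nonneg (hl : ∀ᵐ x ∂ν, 0 ≤ l x) (g : (Fin n → ℝ) →ᵇ ℝ) : ∀ᵐ x ∂ν, 0 ≤ Pg ν l g x := by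
  filter_upwards [hl, mulL_coe ν (NormedSpace.exp g) l] with x h1 h2
  rw [Pg, h2, bcf_exp_apply]
  exact mul_nonneg (Real.exp_pos _).le h1

theorem Pg_pos (hl : ∀ᵐ x ∂ν, 0 ≤ l x) (hl0 : l ≠ 0) (g : (Fin n → ℝ) →ᵇ ℝ) :
    0 < IL ν (Pg ν l g) := by
  rw [IL_eq_norm ν _ (Pg_nonneg ν l hl g), norm_pos_iff]
  intro h
  apply hl0
  have : mulL ν (NormedSpace.exp (-g)) (Pg ν l g) = l := by
    rw [Pg, ← mulL_mul]
    apply Lp.ext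
    filter_upwards [mulL_coe ν (NormedSpace.exp (-g) * NormedSpace.exp g) l] with x hx
    rw [hx, BoundedContinuousFunction.mul_apply, bcf_exp_apply, bcf_exp_apply, ← Real.exp_add]
    simp
  rw [← this, h, map_zero]

theorem Ug_nonneg (hΛ : 0 < Λ) (hl : ∀ᵐ x ∂ν, 0 ≤ l x) (hl0 : l ≠ 0) (g : (Fin n → ℝ) →ᵇ ℝ) :
    ∀ᵐ x ∂ν, 0 ≤ Ug ν Λ l g x := by
  have hp := Pg_pos ν l hl hl0 g
  filter_upwards [Pg_nonneg ν l hl g, Lp.coeFn_smul (Λ * (IL ν (Pg ν l g))⁻¹) (Pg ν l g)] with x h1 h2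
  rw [Ug, h2, Pi.smul_apply, smul_eq_mul]
  positivity

theorem Ug_int (hl : ∀ᵐ x ∂ν, 0 ≤ l x) (hl0 : l ≠ 0) (g : (Fin n → ℝ) →ᵇ ℝ) :
    IL ν (Ug ν Λ l g) = Λ := by
  have hp := Pg_pos ν l hl hl0 g
  rw [Ug, map_smul, smul_eq_mul]
  field_simp

theorem Ug_norm (hΛ : 0 < Λ) (hl : ∀ᵐ x ∂ν, 0 ≤ l x) (hl0 : l ≠ 0) (g : (Fin n → ℝ) →ᵇ ℝ) :
    ‖Ug ν Λ l g‖ = Λ := by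
  rw [← IL_eq_norm ν _ (Ug_nonneg ν Λ l hΛ hl hl0 g), Ug_int ν Λ l hl hl0]

theorem Ug_deriv (hΛ : 0 < Λ) (hl : ∀ᵐ x ∂ν, 0 ≤ l x) (hl0 : l ≠ 0) (g : (Fin n → ℝ) →ᵇ ℝ) :
    HasFDerivAt (Ug ν Λ l) (JL ν Λ (Ug ν Λ l g)) g := by
  have hp := Pg_pos ν l hl hl0 g
  have h1 : HasFDerivAt (Pg ν l) ((mulL ν).flip (Pg ν l g)) g := by
    have := ((mulL ν).flip l).hasFDerivAt.comp g (hasFDerivAt_exp (𝕂 := ℝ) (x := g))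
    refine this.congr_fderiv ?_
    ext1 δ
    simp [Pg, ← mulL_mul, mul_comm]
  have h2 : HasFDerivAt (fun g => IL ν (Pg ν l g)) ((IL ν).comp ((mulL ν).flip (Pg ν l g))) g :=
    (IL ν).hasFDerivAt.comp g h1
  have h3 := ((hasDerivAt_inv hp.ne').comp_hasFDerivAt g h2).const_mul Λ
  have h4 := h3.smul h1
  refine h4.congr_fderiv ?_
  ext1 δ
  rw [JL_apply]
  simp only [Ug, add_apply, smul_apply,
    ContinuousLinearMap.smulRight_apply, ContinuousLinearMap.flip_apply,
    ContinuousLinearMap.comp_apply, map_smul, smul_eq_mul, Function.comp_apply]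
  rw [sub_eq_add_neg, smul_smul, ← neg_smul]
  congr 2
  field_simp

theorem Ug_lip (hΛ : 0 < Λ) (hl : ∀ᵐ x ∂ν, 0 ≤ l x) (hl0 : l ≠ 0) (g h : (Fin n → ℝ) →ᵇ ℝ) :
    ‖Ug ν Λ l g - Ug ν Λ l h‖ ≤ 2 * Λ * ‖g - h‖ :=
  convex_univ.norm_image_sub_le_of_norm_hasFDerivWithin_le (𝕜 := ℝ)
    (fun x _ => (Ug_deriv ν Λ l hΛ hl hl0 x).hasFDerivWithinAt)
    (fun x _ => JL_norm ν hΛ _ (Ug_norm ν Λ l hΛ hl hl0 x)) (mem_univ h) (mem_univ g)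

theorem Ug_zero (hΛ : 0 < Λ) (hlΛ : IL ν l = Λ) : Ug ν Λ l 0 = l := by
  have : Pg ν l 0 = l := by
    rw [Pg]
    apply Lp.ext
    filter_upwards [mulL_coe ν (NormedSpace.exp 0) l] with x hx
    rw [hx, bcf_exp_apply]
    simp
  rw [Ug, this, hlΛ, mul_inv_cancel₀ hΛ.ne', one_smul]

theorem core_dyn (hΛ : 0 < Λ) (hl : ∀ᵐ x ∂ν, 0 ≤ l x) (hlΛ : IL ν l = Λ)
    (om : Lp ℝ 1 ν → ((Fin n → ℝ) →ᵇ ℝ)) (hom : LipB (annu ν Λ) om) :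
    ∃ u : ℝ → Lp ℝ 1 ν, u 0 = l ∧ (∀ t, HasDerivAt u (JL ν Λ (u t) (om (u t))) t) ∧
      ∀ t, (∀ᵐ x ∂ν, 0 ≤ u t x) ∧ IL ν (u t) = Λ ∧ ‖u t‖ = Λ := by
  have hl0 : l ≠ 0 := by
    rintro rfl
    rw [map_zero] at hlΛ
    exact hΛ.ne hlΛ
  have hU : ∀ g, Ug ν Λ l g ∈ annu ν Λ := fun g => by
    have := Ug_norm ν Λ l hΛ hl hl0 g
    exact ⟨by rw [this]; linarith, by rw [this]; linarith⟩
  have hfield : LipB univ (fun g => om (Ug ν Λ l g)) := by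
    obtain ⟨C, hC, h1, h2⟩ := hom
    refine ⟨C + C * (2 * Λ), by positivity, fun g _ => ?_, fun g _ h _ => ?_⟩
    · have := h1 _ (hU g)
      have : 0 ≤ C * (2 * Λ) := by positivity
      linarith
    · have h3 := h2 _ (hU g) _ (hU h)
      have h4 := mul_le_mul_of_nonneg_left (Ug_lip ν Λ l hΛ hl hl0 g h) hC
      have : 0 ≤ C * ‖g - h‖ := by positivity
      linarith
  obtain ⟨g, hg0, hg⟩ := exists_global_curve _ hfield 0
  refine ⟨fun t => Ug ν Λ l (g t), ?_, fun t => ?_, fun t => ?_⟩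
  · simp only [hg0]; exact Ug_zero ν Λ l hΛ hlΛ
  · exact (Ug_deriv ν Λ l hΛ hl hl0 (g t)).comp_hasDerivAt t (hg t)
  · exact ⟨Ug_nonneg ν Λ l hΛ hl hl0 _, Ug_int ν Λ l hl hl0 _, Ug_norm ν Λ l hΛ hl hl0 _⟩

theorem JL_LipB (hΛ : 0 < Λ) (om : Lp ℝ 1 ν → ((Fin n → ℝ) →ᵇ ℝ)) (hom : LipB (annu ν Λ) om) :
    LipB (annu ν Λ) (fun f => JL ν Λ f (om f)) := by
  have h1 := hom.bilin (mulL ν) (LipB_id ν hΛ)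
  have h2 := h1.sub (LipB.bilin (ContinuousLinearMap.lsmul ℝ ℝ)
    ((h1.clm (IL ν)).smul_const (1 / Λ)) (LipB_id ν hΛ))
  simpa only [JL_apply, ContinuousLinearMap.lsmul_apply, smul_eq_mul] using h2

end dyn

section bridge
variable {n : ℕ} {Ω : Set (Fin n → ℝ)}
  (k : C((Fin n → ℝ) × (Fin n → ℝ), ℝ)) (k0 k1 : ℝ) (hk0 : 0 < k0)
  (hk : ∀ p, k p ∈ Icc k0 k1) {T : (Fin n → ℝ) → (Fin n → ℝ) → ℝ} {σ F : ℝ}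

theorem price_eq (hΩ : MeasurableSet Ω) (hkT : ∀ x ∈ Ω, ∀ y ∈ Ω, k (x, y) = T x y ^ (1 - σ))
    (f : Lp ℝ 1 (volume.restrict Ω)) {x : Fin n → ℝ} (hx : x ∈ Ω) :
    priceIndex Ω F σ T f x =
      (Aop (volume.restrict Ω) k k0 k1 hk0 hk F f x) ^ (1 / (1 - σ)) := by
  have : ∫ y in Ω, |f y| * T x y ^ (1 - σ) = KL (volume.restrict Ω) k k0 k1 hk0 hk |f| x := by
    rw [KL_apply]
    apply integral_congr_ae
    filter_upwards [Lp.coeFn_abs f, ae_restrict_mem hΩ] with y h1 h2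
    rw [h1, hkT x hx y h2]
  rw [priceIndex, this]
  rfl

theorem price_pow (hF : 0 < F) (hσ : 1 < σ) (hΩ : MeasurableSet Ω)
    (hkT : ∀ x ∈ Ω, ∀ y ∈ Ω, k (x, y) = T x y ^ (1 - σ))
    (f : Lp ℝ 1 (volume.restrict Ω)) {x : Fin n → ℝ} (hx : x ∈ Ω) (q : ℝ) :
    priceIndex Ω F σ T f x ^ q =
      (Aop (volume.restrict Ω) k k0 k1 hk0 hk F f x) ^ (-q / (σ - 1)) := by
  rw [price_eq k k0 k1 hk0 hk hΩ hkT f hx, ← Real.rpow_mul]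
  · congr 1
    have h1 : σ - 1 ≠ 0 := by linarith
    have h2 : 1 - σ ≠ 0 := by linarith
    field_simp
    ring
  · refine le_trans ?_ (Aop_mem (volume.restrict Ω) k k0 k1 hk0 hk hF f x).1
    positivity

theorem wage_int (hF : 0 < F) (hσ : 1 < σ) (hΩ : MeasurableSet Ω)
    (hkT : ∀ x ∈ Ω, ∀ y ∈ Ω, k (x, y) = T x y ^ (1 - σ))
    (f h : Lp ℝ 1 (volume.restrict Ω)) (W φ : (Fin n → ℝ) → ℝ) (iA : (Fin n → ℝ) →ᵇ ℝ)
    (hiA : ∀ x, iA x = (Aop (volume.restrict Ω) k k0 k1 hk0 hk F f x)⁻¹)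
    (hh : h =ᵐ[volume.restrict Ω] fun y => W y * |f y| + φ y) (c : ℝ)
    {x : Fin n → ℝ} (hx : x ∈ Ω) :
    c * ∫ y in Ω, (W y * |f y| + φ y) * priceIndex Ω F σ T f y ^ (σ - 1) * T x y ^ (1 - σ) =
      (c • KL (volume.restrict Ω) k k0 k1 hk0 hk (mulL (volume.restrict Ω) iA h)) x := by
  rw [BoundedContinuousFunction.smul_apply, smul_eq_mul, KL_apply]
  congr 1
  apply integral_congr_ae
  filter_upwards [hh, mulL_coe (volume.restrict Ω) iA h, ae_restrict_mem hΩ] with y h1 h2 h3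
  rw [h2, h1, hkT x hx y h3, hiA, price_pow k k0 k1 hk0 hk hF hσ hΩ hkT f h3]
  have : -(σ - 1) / (σ - 1) = -1 := by
    have h1 : σ - 1 ≠ 0 := by linarith
    field_simp
  rw [this, Real.rpow_neg_one]
  ring

theorem psi_eq (hF : 0 < F) (hσ : 1 < σ) (hΩ : MeasurableSet Ω)
    (hkT : ∀ x ∈ Ω, ∀ y ∈ Ω, k (x, y) = T x y ^ (1 - σ))
    (f : Lp ℝ 1 (volume.restrict Ω)) (W : (Fin n → ℝ) → ℝ) (w rp : (Fin n → ℝ) →ᵇ ℝ)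
    (Λ v μ : ℝ)
    (hrp : ∀ x, rp x = (Aop (volume.restrict Ω) k k0 k1 hk0 hk F f x) ^ (μ / (σ - 1)))
    (hW : ∀ x ∈ Ω, W x = w x) :
    JL (volume.restrict Ω) Λ f (v • (w * rp)) =ᵐ[volume.restrict Ω]
      psiOf Ω F σ μ Λ v T f W := by
  have hom : ∀ x ∈ Ω, omegaOf Ω F σ μ T f W x = w x * rp x := by
    intro x hx
    rw [omegaOf, price_pow k k0 k1 hk0 hk hF hσ hΩ hkT f hx, hW x hx, hrp, neg_neg]
  have h_integ : IL (volume.restrict Ω) (mulL (volume.restrict Ω) (w * rp) f) =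
      ∫ y in Ω, omegaOf Ω F σ μ T f W y * f y := by
    rw [IL_apply]
    apply integral_congr_ae
    filter_upwards [mulL_coe (volume.restrict Ω) (w * rp) f, ae_restrict_mem hΩ] with y h1 h2
    rw [h1, hom y h2]; rfl
  have e : JL (volume.restrict Ω) Λ f (v • (w * rp)) =
      v • (mulL (volume.restrict Ω) (w * rp) f -
        ((1 / Λ) * IL (volume.restrict Ω) (mulL (volume.restrict Ω) (w * rp) f)) • f) := by
    rw [map_smul, JL_apply]
  rw [e, h_integ]
  set I := ∫ y in Ω, omegaOf Ω F σ μ T f W y * f y with hI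
  filter_upwards [mulL_coe (volume.restrict Ω) (w * rp) f, ae_restrict_mem hΩ,
    Lp.coeFn_smul v (mulL (volume.restrict Ω) (w * rp) f - ((1 / Λ) * I) • f),
    Lp.coeFn_sub (mulL (volume.restrict Ω) (w * rp) f) (((1 / Λ) * I) • f),
    Lp.coeFn_smul ((1 / Λ) * I) f] with y h1 h2 h3 h4 h5
  rw [h3, Pi.smul_apply, h4, Pi.sub_apply, h5, h1, psiOf, hom y h2, ← hI]
  simp only [Pi.smul_apply, smul_eq_mul, BoundedContinuousFunction.mul_apply]
  ring

end bridge

theorem global_existence_uniqueness {n : ℕ} (Ω : Set (Fin n → ℝ))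
    (hΩc : IsCompact Ω) (hΩpos : 0 < volume Ω)
    (T : (Fin n → ℝ) → (Fin n → ℝ) → ℝ)
    (hTcont : ContinuousOn (fun p : (Fin n → ℝ) × (Fin n → ℝ) => T p.1 p.2) (Ω ×ˢ Ω))
    (Tmin Tmax : ℝ) (hTmin : 1 ≤ Tmin)
    (hT : ∀ x ∈ Ω, ∀ y ∈ Ω, T x y ∈ Icc Tmin Tmax)
    (σ μ F v Λ Φ : ℝ) (hσ : 1 < σ) (hμ : μ ∈ Ioo (0 : ℝ) 1) (hF : 0 < F)
    (hv : 0 < v) (hΛ : 0 < Λ) (hΦ : 0 < Φ)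
    (φ : (Fin n → ℝ) → ℝ) (hφint : IntegrableOn φ Ω)
    (hφ0 : ∀ᵐ x ∂(volume.restrict Ω), 0 ≤ φ x) (hφΦ : (∫ x in Ω, φ x) = Φ)
    (hcond : ∃ b : ℝ, 0 < b ∧ b < Λ ∧
      μ / σ * (Tmax / Tmin) ^ (σ - 1) * ((Λ + b) / (Λ - b)) < 1)
    (lam₀ : (Fin n → ℝ) → ℝ) (hlam₀ : IntegrableOn lam₀ Ω)
    (hlam₀0 : ∀ᵐ x ∂(volume.restrict Ω), 0 ≤ lam₀ x)
    (hlam₀Λ : (∫ x in Ω, lam₀ x) = Λ) :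
    ∃ u D : ℝ → Lp ℝ 1 (volume.restrict Ω),
      IsSolutionOn Ω F σ μ Λ v T φ lam₀ (Ici 0) u D ∧
      (∀ t ∈ Ici (0 : ℝ),
        (∀ᵐ x ∂(volume.restrict Ω), 0 ≤ (u t : (Fin n → ℝ) → ℝ) x) ∧
        (∫ x in Ω, (u t : (Fin n → ℝ) → ℝ) x) = Λ) ∧
      ∀ u' D' : ℝ → Lp ℝ 1 (volume.restrict Ω),
        IsSolutionOn Ω F σ μ Λ v T φ lam₀ (Ici 0) u' D' →
        ∀ t ∈ Ici (0 : ℝ), u' t = u t := by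
  have hΩm : MeasurableSet Ω := hΩc.measurableSet
  obtain ⟨x0, hx0⟩ : Ω.Nonempty := by
    rw [nonempty_iff_ne_empty]
    rintro rfl
    simp at hΩpos
  obtain ⟨hμ0, hμ1⟩ := hμ
  have hTminp : 0 < Tmin := by linarith
  have hTle : Tmin ≤ Tmax := (hT x0 hx0 x0 hx0).1.trans (hT x0 hx0 x0 hx0).2
  have hTmaxp : 0 < Tmax := hTminp.trans_le hTle
  have hk0 : 0 < Tmax ^ (1 - σ) := Real.rpow_pos_of_pos hTmaxp _
  have hTk : ∀ x ∈ Ω, ∀ y ∈ Ω, T x y ^ (1 - σ) ∈ Icc (Tmax ^ (1 - σ)) (Tmin ^ (1 - σ)) := by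
    intro x hx y hy
    have h := hT x hx y hy
    exact ⟨Real.rpow_le_rpow_of_nonpos (hTminp.trans_le h.1) h.2 (by linarith),
      Real.rpow_le_rpow_of_nonpos hTminp h.1 (by linarith)⟩
  -- Tietze extension of the kernel
  obtain ⟨k, hk, hkr⟩ : ∃ k : C((Fin n → ℝ) × (Fin n → ℝ), ℝ),
      (∀ p, k p ∈ Icc (Tmax ^ (1 - σ)) (Tmin ^ (1 - σ))) ∧
      ∀ x ∈ Ω, ∀ y ∈ Ω, k (x, y) = T x y ^ (1 - σ) := by
    have hc : ContinuousOn (fun p : (Fin n → ℝ) × (Fin n → ℝ) => T p.1 p.2 ^ (1 - σ)) (Ω ×ˢ Ω) :=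
      hTcont.rpow_const fun p hp => Or.inl
        (ne_of_gt (hTminp.trans_le (hT p.1 hp.1 p.2 hp.2).1))
    obtain ⟨g, hg, hgr⟩ := ContinuousMap.exists_restrict_eq_forall_mem_of_closed
      (s := Ω ×ˢ Ω) (t := Icc (Tmax ^ (1 - σ)) (Tmin ^ (1 - σ)))
      ⟨_, hc.domRestrict⟩ (fun p => hTk _ p.2.1 _ p.2.2) ⟨_, hTk x0 hx0 x0 hx0⟩
      (hΩc.isClosed.prod hΩc.isClosed)
    refine ⟨g, hg, fun x hx y hy => ?_⟩
    have := DFunLike.congr_fun hgr ⟨(x, y), hx, hy⟩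
    exact this
  have hκ : μ / σ * (Tmin ^ (1 - σ) / Tmax ^ (1 - σ)) < 1 := by
    obtain ⟨b, hb0, hbΛ, hb⟩ := hcond
    have e : Tmin ^ (1 - σ) / Tmax ^ (1 - σ) = (Tmax / Tmin) ^ (σ - 1) := by
      rw [Real.div_rpow hTmaxp.le hTminp.le, show 1 - σ = -(σ - 1) by ring,
        Real.rpow_neg hTminp.le, Real.rpow_neg hTmaxp.le]
      field_simp
    rw [e]
    have h1 : 1 ≤ (Λ + b) / (Λ - b) := by
      rw [le_div_iff₀ (by linarith)]; linarith
    have h2 : 0 ≤ μ / σ * (Tmax / Tmin) ^ (σ - 1) := by positivity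
    nlinarith
  set k0 := Tmax ^ (1 - σ) with hk0d
  set k1 := Tmin ^ (1 - σ) with hk1d
  let ν : Measure (Fin n → ℝ) := volume.restrict Ω
  have hφint' : Integrable φ ν := hφint
  have hlam' : Integrable lam₀ ν := hlam₀
  let φL : Lp ℝ 1 ν := hφint'.toL1 φ
  let l : Lp ℝ 1 ν := hlam'.toL1 lam₀
  have hφL : φL =ᵐ[ν] φ := hφint'.coeFn_toL1
  have hlL : l =ᵐ[ν] lam₀ := hlam'.coeFn_toL1
  have hl0 : ∀ᵐ x ∂ν, 0 ≤ l x := by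
    filter_upwards [hlL, hlam₀0] with x h1 h2
    rw [h1]; exact h2
  have hlΛ : IL ν l = Λ := by
    rw [IL_apply, integral_congr_ae hlL]; exact hlam₀Λ
  obtain ⟨iA, rp, w, hrpL, hwL, hw⟩ := core_wage ν k k0 k1 hk0 hk F σ μ Λ (μ / (σ - 1)) hF
    (by linarith) hμ0 hΛ hκ φL (by
      filter_upwards [hφL, hφ0] with x h1 h2
      rw [h1]; exact h2)
  -- wage solutions
  have hWsol : ∀ f ∈ annu ν Λ, IsWageSolution Ω F σ μ T φ f (w f) := by
    intro f hf
    obtain ⟨h1, h2, h3, h4, h5⟩ := hw f hf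
    refine ⟨(w f).continuous.continuousOn, fun x _ => h3 x, fun x hx => ?_⟩
    rw [wage_int k k0 k1 hk0 hk hF hσ hΩm hkr f (mulL ν (w f) |f| + φL) (w f) φ (iA f) h1 ?_ _ hx]
    · exact DFunLike.congr_fun h4 x
    · filter_upwards [Lp.coeFn_add (mulL ν (w f) |f|) φL, mulL_coe ν (w f) |f|, Lp.coeFn_abs f,
        hφL] with y e1 e2 e3 e4
      rw [e1, Pi.add_apply, e2, e3, e4]
  have hWuniq : ∀ f ∈ annu ν Λ, ∀ W, IsWageSolution Ω F σ μ T φ f W → ∀ x ∈ Ω, W x = w f x := by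
    intro f hf W hW
    obtain ⟨h1, h2, h3, h4, h5⟩ := hw f hf
    obtain ⟨hWc, hW0, hWe⟩ := hW
    obtain ⟨C, hC⟩ := hΩc.exists_bound_of_continuousOn hWc
    have h_integ : Integrable (fun y => W y * |f y| + φ y) ν := by
      refine Integrable.add ?_ hφint'
      refine (L1.integrable_coeFn f).abs.bdd_mul (c := C) (hWc.aestronglyMeasurable hΩm) ?_
      filter_upwards [ae_restrict_mem hΩm] with y hy
      exact hC y hy
    let h : Lp ℝ 1 ν := h_integ.toL1 _
    have hh : h =ᵐ[ν] fun y => W y * |f y| + φ y := h_integ.coeFn_toL1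
    let W' : (Fin n → ℝ) →ᵇ ℝ := (μ / (σ * F)) • KL ν k k0 k1 hk0 hk (mulL ν (iA f) h)
    have hWW' : ∀ x ∈ Ω, W x = W' x := fun x hx => by
      rw [hWe x hx]
      exact wage_int k k0 k1 hk0 hk hF hσ hΩm hkr f h W φ (iA f) h1 hh _ hx
    have hhe : h = mulL ν W' |f| + φL := by
      apply Lp.ext
      filter_upwards [Lp.coeFn_add (mulL ν W' |f|) φL, mulL_coe ν W' |f|, Lp.coeFn_abs f,
        hφL, hh, ae_restrict_mem hΩm] with y e1 e2 e3 e4 e5 e6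
      rw [e5, e1, Pi.add_apply, e2, e3, e4, hWW' y e6]
    have hfix : W' = (μ / (σ * F)) • KL ν k k0 k1 hk0 hk (mulL ν (iA f) (mulL ν W' |f| + φL)) := by
      rw [← hhe]
    intro x hx
    rw [hWW' x hx, h5 W' hfix]
  let om : Lp ℝ 1 ν → ((Fin n → ℝ) →ᵇ ℝ) := fun f => v • (w f * rp f)
  have homL : LipB (annu ν Λ) om :=
    (LipB.bilin (ContinuousLinearMap.mul ℝ ((Fin n → ℝ) →ᵇ ℝ)) hwL hrpL).smul_const v
  have hPsi : ∀ f ∈ annu ν Λ, ∀ W, IsWageSolution Ω F σ μ T φ f W →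
      JL ν Λ f (om f) =ᵐ[ν] psiOf Ω F σ μ Λ v T f W := fun f hf W hW =>
    psi_eq k k0 k1 hk0 hk hF hσ hΩm hkr f W (w f) (rp f) Λ v μ (hw f hf).2.1 (hWuniq f hf W hW)
  have hJ := JL_LipB ν Λ hΛ om homL
  obtain ⟨u, hu0, hu, huΛ⟩ := core_dyn ν Λ l hΛ hl0 hlΛ om homL
  have hmem : ∀ t, u t ∈ annu ν Λ := fun t => by
    have := (huΛ t).2.2
    exact ⟨by rw [this]; linarith, by rw [this]; linarith⟩
  have hnhds : ∀ t, annu ν Λ ∈ 𝓝 (u t) := fun t => by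
    have h1 : ∀ᶠ f in 𝓝 (u t), ‖f‖ ∈ Ioo (Λ / 2) (2 * Λ) := by
      refine continuous_norm.continuousAt.eventually (Ioo_mem_nhds ?_ ?_)
      · change Λ / 2 < ‖u t‖; rw [(huΛ t).2.2]; linarith
      · change ‖u t‖ < 2 * Λ; rw [(huΛ t).2.2]; linarith
    filter_upwards [h1] with f hf
    exact ⟨hf.1.le, hf.2.le⟩
  refine ⟨u, fun t => JL ν Λ (u t) (om (u t)), ⟨?_, ?_, ?_⟩, ?_, ?_⟩
  · rw [hu0]; exact hlL
  · obtain ⟨K, hK⟩ := hJ.lipschitzOnWith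
    have hcu : Continuous u := continuous_iff_continuousAt.2 fun t => (hu t).continuousAt
    exact hK.continuousOn.comp hcu.continuousOn (fun t _ => hmem t)
  · intro t _
    exact ⟨(hu t).hasDerivWithinAt, w (u t), hWsol _ (hmem t), hPsi _ (hmem t) _ (hWsol _ (hmem t))⟩
  · intro t _
    refine ⟨(huΛ t).1, ?_⟩
    have := (huΛ t).2.1
    rwa [IL_apply] at this
  · intro u' D' ⟨h0', hD', hsol⟩
    refine unique_curve (fun f => JL ν Λ f (om f)) (annu ν Λ) hJ u u' D'
      (fun t _ => (hu t).hasDerivWithinAt) (fun t _ => hnhds t) (fun t ht => (hsol t ht).1) ?_ ?_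
    · intro t ht hmt
      obtain ⟨-, W, hW, hDW⟩ := hsol t ht
      exact Lp.ext (hDW.trans (hPsi _ hmt W hW).symm)
    · rw [hu0]
      exact Lp.ext (h0'.trans hlL.symm)
end
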